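/- arXiv:1501.00251 — 3 statements merged into one kernel-verified Lean document; each statement's English description precedes it below -/
import Mathlib

section
/- Let −1 < ρ < 0 and μ ∈ ℝ, and for x > 0 set Y(x) = (1+ρ)((−ρ)^{−ρ} x)^{1/(1+ρ)}. Then there exist a constant A₀ ∈ ℝ and constants C > 0, X > 0 such that for all x ≥ X one has |W_{ρ,μ}(−x) − A₀ · Y(x)^{1/2−μ} e^{−Y(x)}| ≤ C · Y(x)^{−1/2−μ} e^{−Y(x)}; in particular W_{ρ,μ}(−x) = Y(x)^{1/2−μ} e^{−Y(x)} (A₀ + O(Y(x)^{−1})) as x → +∞, so the Wright function decays exponentially on the negative real axis. -/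
open scoped Real

/-- Two-parameter Mittag-Leffler function (complex argument). -/
noncomputable def mlC (a b : ℝ) (z : ℂ) : ℂ :=
  ∑' k : ℕ, z ^ k / Complex.Gamma (((k : ℝ) * a + b : ℝ) : ℂ)

/-- Two-parameter Mittag-Leffler function (real argument). -/
noncomputable def mlR (a b : ℝ) (x : ℝ) : ℝ :=
  ∑' k : ℕ, x ^ k / Real.Gamma ((k : ℝ) * a + b)

/-- Wright function (real argument). -/
noncomputable def wrightR (p m : ℝ) (x : ℝ) : ℝ :=
  ∑' k : ℕ, x ^ k / ((k.factorial : ℝ) * Real.Gamma (p * (k : ℝ) + m))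

/-- Djrbashian-Caputo fractional derivative of order `g ∈ (0,1)` (real-valued). -/
noncomputable def caputoR (g : ℝ) (f : ℝ → ℝ) (t : ℝ) : ℝ :=
  (1 / Real.Gamma (1 - g)) * ∫ s in (0:ℝ)..t, (t - s) ^ (-g) * deriv f s

/-- Djrbashian-Caputo fractional derivative of order `b ∈ (1,2)` (complex-valued). -/
noncomputable def caputoC2 (b : ℝ) (f : ℝ → ℂ) (x : ℝ) : ℂ :=
  (1 / Complex.Gamma ((2 - b : ℝ) : ℂ)) *
    ∫ s in (0:ℝ)..x, (((x - s) ^ (1 - b) : ℝ) : ℂ) * deriv (deriv f) s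

/-- Riemann–Liouville fractional derivative of order `b ∈ (1,2)` (complex-valued). -/
noncomputable def rlC2 (b : ℝ) (f : ℝ → ℂ) (x : ℝ) : ℂ :=
  deriv (deriv (fun y : ℝ =>
    (1 / Complex.Gamma ((2 - b : ℝ) : ℂ)) *
      ∫ s in (0:ℝ)..y, (((y - s) ^ (1 - b) : ℝ) : ℂ) * f s)) x

/-- `Y(x) = (1+ρ)((−ρ)^{−ρ} x)^{1/(1+ρ)}`. -/
noncomputable def Yfun (p x : ℝ) : ℝ := (1 + p) * ((-p) ^ (-p) * x) ^ (1 / (1 + p))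

section WrightAsymptotics

open MeasureTheory Filter Topology Complex

/-- The parametrized vertical line `Re u = a`. -/
noncomputable def verticalLine (a y : ℝ) : ℂ := a + y * I

lemma continuous_verticalLine (a : ℝ) : Continuous (verticalLine a) := by
  unfold verticalLine; fun_prop

lemma verticalLine_re (a y : ℝ) : (verticalLine a y).re = a := by simp [verticalLine]

lemma verticalLine_im (a y : ℝ) : (verticalLine a y).im = y := by simp [verticalLine]

lemma norm_verticalLine_sq (a y : ℝ) : ‖verticalLine a y‖ ^ 2 = a ^ 2 + y ^ 2 := by
  rw [Complex.sq_norm, Complex.normSq_apply, verticalLine_re, verticalLine_im]; ring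

lemma le_norm_verticalLine (a y : ℝ) : a ≤ ‖verticalLine a y‖ := by
  simpa [verticalLine_re] using (Complex.re_le_norm (verticalLine a y))

lemma norm_cexp_verticalLine_sq (a y : ℝ) :
    ‖cexp (verticalLine a y ^ 2)‖ = Real.exp (a ^ 2 - y ^ 2) := by
  rw [Complex.norm_exp, pow_two, Complex.mul_re, verticalLine_re, verticalLine_im]
  ring_nf

lemma verticalLine_mem_slitPlane {a : ℝ} (ha : 0 < a) (y : ℝ) :
    verticalLine a y ∈ slitPlane := by
  left; rwa [verticalLine_re]

lemma verticalLine_ne_zero {a : ℝ} (ha : 0 < a) (y : ℝ) : verticalLine a y ≠ 0 :=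
  slitPlane_ne_zero (verticalLine_mem_slitPlane ha y)

lemma hasDerivAt_verticalLine (a y : ℝ) : HasDerivAt (verticalLine a) I y := by
  have h := ((Complex.ofRealCLM.hasDerivAt (x := y)).mul_const I).const_add (a : ℂ)
  rw [ofRealCLM_apply, ofReal_one] at h
  rw [one_mul] at h
  exact h

lemma hasDerivAt_verticalLine_cpow {a : ℝ} (ha : 0 < a) (c : ℂ) (y : ℝ) :
    HasDerivAt (fun y => verticalLine a y ^ c) (I * c * verticalLine a y ^ (c - 1)) y := by
  have h := ((hasDerivAt_id _).cpow_const (c := c)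
    (verticalLine_mem_slitPlane ha y)).comp y (hasDerivAt_verticalLine a y)
  exact h.congr_deriv (by simp only [id, verticalLine]; ring)

/-- Powers times stretched exponentials of order less than two are dominated by a Gaussian. -/
lemma exists_rpow_mul_exp_le {a q x p : ℝ} (haq : 0 < a ∨ 0 ≤ q)
    (hp : 0 < p) (hp2 : p < 2) :
    ∃ C, 0 ≤ C ∧ ∀ r, a ≤ r → r ^ q * Real.exp (x * r ^ p) ≤ C * Real.exp (r ^ 2 / 2) := by
  have hlim : Tendsto (fun r : ℝ => x * r ^ (-(2 - p)) + r ^ (-1 : ℝ)) atTop (𝓝 (x * 0 + 0)) :=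
    ((tendsto_rpow_neg_atTop (by linarith)).const_mul x).add (tendsto_rpow_neg_atTop one_pos)
  have h1 := hlim.eventually (eventually_le_nhds (show x * 0 + 0 < (1 : ℝ) / 2 by norm_num))
  have h2 := (tendsto_rpow_mul_exp_neg_mul_atTop_nhds_zero q 1 one_pos).eventually
    (eventually_le_nhds (show (0 : ℝ) < 1 by norm_num))
  obtain ⟨R, hR⟩ := eventually_atTop.1 (h1.and (h2.and (eventually_gt_atTop 0)))
  have hcont : ContinuousOn (fun r : ℝ => r ^ q * Real.exp (x * r ^ p)) (Set.Icc a R) := by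
    refine ContinuousOn.mul ?_ ?_
    · refine continuousOn_id.rpow_const fun r hr => ?_
      rcases haq with h | h
      · exact Or.inl (by simpa using (h.trans_le hr.1).ne')
      · exact Or.inr h
    · refine Real.continuous_exp.comp_continuousOn (continuousOn_const.mul ?_)
      exact continuousOn_id.rpow_const fun r hr => Or.inr hp.le
  obtain ⟨C, hC⟩ := isCompact_Icc.exists_bound_of_continuousOn hcont
  refine ⟨max C 1, le_max_of_le_right zero_le_one, fun r hr => ?_⟩
  rcases le_total r R with h | h
  · have := (Real.norm_eq_abs _ ▸ hC r ⟨hr, h⟩ : |_| ≤ C)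
    calc _ ≤ C := (le_abs_self _).trans this
      _ ≤ max C 1 := le_max_left _ _
      _ = max C 1 * 1 := by ring
      _ ≤ _ := by
        gcongr
        exact Real.one_le_exp (by positivity)
  · obtain ⟨h3, h4, h5⟩ := hR r h
    have h6 : x * r ^ p + r ≤ r ^ 2 / 2 := by
      have h7 : r ^ p = r ^ (-(2 - p)) * r ^ 2 := by
        rw [← Real.rpow_natCast r 2, ← Real.rpow_add h5]
        congr 1; push_cast; ring
      have h8 : r = r ^ (-1 : ℝ) * r ^ 2 := by
        rw [Real.rpow_neg_one]; field_simp
      calc x * r ^ p + r = (x * r ^ (-(2 - p)) + r ^ (-1 : ℝ)) * r ^ 2 := by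
            rw [h7, add_mul, ← h8]; ring
        _ ≤ 1 / 2 * r ^ 2 := by gcongr
        _ = r ^ 2 / 2 := by ring
    calc r ^ q * Real.exp (x * r ^ p)
        = (r ^ q * Real.exp (-1 * r)) * Real.exp (x * r ^ p + r) := by
          rw [mul_assoc, ← Real.exp_add]; ring_nf
      _ ≤ 1 * Real.exp (r ^ 2 / 2) := by gcongr
      _ ≤ _ := by gcongr; exact le_max_right _ _

lemma integrable_gaussian_mul_weight {a q x p : ℝ} (haq : 0 < a ∨ 0 ≤ q)
    (hp : 0 < p) (hp2 : p < 2) :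
    Integrable fun y : ℝ => Real.exp (a ^ 2 - y ^ 2) *
      (‖verticalLine a y‖ ^ q * Real.exp (x * ‖verticalLine a y‖ ^ p)) := by
  obtain ⟨C, hC0, hC⟩ := exists_rpow_mul_exp_le (x := x) haq hp hp2
  have hdom : Integrable fun y : ℝ =>
      (C * Real.exp (3 / 2 * a ^ 2)) * Real.exp (-(1 / 2) * y ^ 2) :=
    (integrable_exp_neg_mul_sq (by norm_num)).const_mul _
  refine hdom.mono' ?_ (ae_of_all _ fun y => ?_)
  · refine Continuous.aestronglyMeasurable ?_
    have hn : Continuous fun y => ‖verticalLine a y‖ := (continuous_verticalLine a).norm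
    refine (by fun_prop : Continuous fun y : ℝ => Real.exp (a ^ 2 - y ^ 2)).mul
      (Continuous.mul ?_ (Real.continuous_exp.comp (continuous_const.mul ?_)))
    · refine hn.rpow_const fun y => ?_
      rcases haq with h | h
      · exact Or.inl (h.trans_le (le_norm_verticalLine a y)).ne'
      · exact Or.inr h
    · exact hn.rpow_const fun y => Or.inr hp.le
  · rw [Real.norm_of_nonneg (by positivity)]
    calc _ ≤ Real.exp (a ^ 2 - y ^ 2) * (C * Real.exp (‖verticalLine a y‖ ^ 2 / 2)) := by
          exact mul_le_mul_of_nonneg_left (hC _ (le_norm_verticalLine a y)) (Real.exp_nonneg _)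
      _ = _ := by
        rw [norm_verticalLine_sq, mul_left_comm, ← Real.exp_add, mul_assoc, ← Real.exp_add]
        congr 2
        ring

/-- The integrand of the parabolic Hankel representation of `1 / Γ`. -/
noncomputable def hankelIntegrand (q : ℝ) (u : ℂ) : ℂ := cexp (u ^ 2) * u ^ (q : ℂ)

lemma norm_hankelIntegrand (q a y : ℝ) : ‖hankelIntegrand q (verticalLine a y)‖ =
    Real.exp (a ^ 2 - y ^ 2) * ‖verticalLine a y‖ ^ q := by
  rw [hankelIntegrand, norm_mul, norm_cexp_verticalLine_sq, Complex.norm_cpow_real]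

lemma real_mul_cpow {r : ℝ} (hr : 0 < r) {z : ℂ} (hz : z ≠ 0) (w : ℂ) :
    ((r : ℂ) * z) ^ w = (r : ℂ) ^ w * z ^ w := by
  have hr' : (r : ℂ) ≠ 0 := ofReal_ne_zero.2 hr.ne'
  rw [cpow_def_of_ne_zero (mul_ne_zero hr' hz), log_ofReal_mul hr hz, ofReal_log hr.le,
    add_mul, Complex.exp_add, ← cpow_def_of_ne_zero hr', ← cpow_def_of_ne_zero hz]

lemma continuousAt_cpow_ofReal {q : ℝ} {u : ℂ} (h : 0 < u.re ∨ 0 < q ∧ 0 ≤ u.re) :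
    ContinuousAt (fun z : ℂ => z ^ (q : ℂ)) u := by
  by_cases hu : u = 0
  · subst hu
    have hq : 0 < q := by simpa using h
    exact Complex.continuousAt_cpow_const_of_re_pos (Or.inl le_rfl) (by simpa using hq)
  · have hs : u ∈ slitPlane := by
      rcases h with h | ⟨-, h⟩
      · exact Or.inl h
      · rcases h.lt_or_eq with h | h
        · exact Or.inl h
        · exact Or.inr fun him => hu (Complex.ext h.symm him)
    exact continuousAt_cpow_const hs

lemma continuous_hankelIntegrand {a q : ℝ} (h : 0 < a ∨ 0 < q ∧ 0 ≤ a) :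
    Continuous fun y => hankelIntegrand q (verticalLine a y) := by
  unfold hankelIntegrand
  have hc := continuous_verticalLine a
  refine (by fun_prop : Continuous fun y => cexp (verticalLine a y ^ 2)).mul ?_
  refine continuous_iff_continuousAt.2 fun y => ?_
  exact (continuousAt_cpow_ofReal (by rwa [verticalLine_re])).comp
    (f := verticalLine a) hc.continuousAt

lemma integrable_hankelIntegrand {a q : ℝ} (h : 0 < a ∨ 0 < q ∧ 0 ≤ a) :
    Integrable fun y => hankelIntegrand q (verticalLine a y) := by
  refine (integrable_gaussian_mul_weight (a := a) (q := q) (x := 0) (p := 1) ?_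
    one_pos (by norm_num)).mono' (continuous_hankelIntegrand h).aestronglyMeasurable
    (ae_of_all _ fun y => ?_)
  · exact h.imp id fun h => h.1.le
  · simp [norm_hankelIntegrand]

lemma integral_hankelIntegrand_zero {s : ℝ} (hs : s < 1 / 2) :
    ∫ y, hankelIntegrand (1 - 2 * s) (verticalLine 0 y) = Real.pi * (Real.Gamma s : ℂ)⁻¹ := by
  have hq : 0 < 1 - 2 * s := by linarith
  have hint := integrable_hankelIntegrand (a := 0) (q := 1 - 2 * s) (Or.inr ⟨hq, le_rfl⟩)
  have hneg : ∫ y in Set.Iic (0 : ℝ), hankelIntegrand (1 - 2 * s) (verticalLine 0 y) =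
      ∫ y in Set.Ioi (0 : ℝ), hankelIntegrand (1 - 2 * s) (verticalLine 0 (-y)) := by
    rw [integral_comp_neg_Ioi (f := fun y => hankelIntegrand (1 - 2 * s) (verticalLine 0 y)),
      neg_zero]
  rw [← intervalIntegral.integral_Iic_add_Ioi hint.integrableOn hint.integrableOn (b := 0), hneg,
    ← integral_add]
  rotate_left
  · have := hint.comp_neg
    exact this.integrableOn
  · exact hint.integrableOn
  have hval : ∀ y ∈ Set.Ioi (0 : ℝ), hankelIntegrand (1 - 2 * s) (verticalLine 0 (-y)) +
      hankelIntegrand (1 - 2 * s) (verticalLine 0 y) =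
      ((2 * Real.sin (Real.pi * s) : ℝ) : ℂ) *
        ((y ^ (1 - 2 * s) * Real.exp (-y ^ (2 : ℝ)) : ℝ) : ℂ) := by
    intro y hy
    have hy : 0 < y := hy
    have hI : (I : ℂ) ^ ((1 - 2 * s : ℝ) : ℂ) = cexp (((Real.pi / 2 - Real.pi * s : ℝ) : ℂ) * I) := by
      rw [Complex.cpow_def_of_ne_zero I_ne_zero, Complex.log_I]
      congr 1; push_cast; ring
    have hI' : (-I : ℂ) ^ ((1 - 2 * s : ℝ) : ℂ) =
        cexp (-((Real.pi / 2 - Real.pi * s : ℝ) : ℂ) * I) := by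
      rw [Complex.cpow_def_of_ne_zero (by simp), Complex.log_neg_I]
      congr 1; push_cast; ring
    have h1 : (verticalLine 0 y) ^ ((1 - 2 * s : ℝ) : ℂ) =
        ((y ^ (1 - 2 * s) : ℝ) : ℂ) * I ^ ((1 - 2 * s : ℝ) : ℂ) := by
      rw [verticalLine, ofReal_zero, zero_add, real_mul_cpow hy I_ne_zero,
        Complex.ofReal_cpow hy.le]
    have h2 : (verticalLine 0 (-y)) ^ ((1 - 2 * s : ℝ) : ℂ) =
        ((y ^ (1 - 2 * s) : ℝ) : ℂ) * (-I) ^ ((1 - 2 * s : ℝ) : ℂ) := by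
      have : verticalLine 0 (-y) = y * (-I) := by simp [verticalLine]
      rw [this, real_mul_cpow hy (by simp), Complex.ofReal_cpow hy.le]
    have h3 : cexp (verticalLine 0 y ^ 2) = (Real.exp (-y ^ (2 : ℝ)) : ℂ) := by
      simp [verticalLine, mul_pow]
    have h4 : cexp (verticalLine 0 (-y) ^ 2) = (Real.exp (-y ^ (2 : ℝ)) : ℂ) := by
      simp [verticalLine, mul_pow]
    have h5 : cexp (((Real.pi / 2 - Real.pi * s : ℝ) : ℂ) * I) +
        cexp (-((Real.pi / 2 - Real.pi * s : ℝ) : ℂ) * I) = 2 * (Real.sin (Real.pi * s) : ℂ) := by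
      rw [← Real.cos_pi_div_two_sub, Complex.ofReal_cos, Complex.cos]; ring
    rw [hankelIntegrand, hankelIntegrand, h3, h4, h1, h2, hI, hI']
    push_cast at h5 ⊢
    rw [← h5]; ring
  rw [setIntegral_congr_fun measurableSet_Ioi hval, integral_const_mul, integral_complex_ofReal,
    _root_.integral_rpow_mul_exp_neg_rpow two_pos (by linarith)]
  norm_cast
  have hG : 0 < Real.Gamma (1 - s) := Real.Gamma_pos_of_pos (by linarith)
  have href := Real.Gamma_mul_Gamma_one_sub s
  rw [show (1 - 2 * s + 1) / 2 = 1 - s by ring]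
  by_cases hsin : Real.sin (Real.pi * s) = 0
  · rw [hsin, div_zero] at href
    have : Real.Gamma s = 0 := by
      rcases mul_eq_zero.1 href with h | h
      · exact h
      · exact absurd h hG.ne'
    simp [hsin, this]
  · have hGs : Real.Gamma s ≠ 0 := by
      intro h0
      rw [h0, zero_mul] at href
      exact div_ne_zero Real.pi_ne_zero hsin href.symm
    rw [eq_div_iff hsin] at href
    field_simp
    linarith

lemma differentiableAt_hankelIntegrand (q : ℝ) {u : ℂ} (hu : 0 < u.re) :
    DifferentiableAt ℂ (hankelIntegrand q) u := by
  unfold hankelIntegrand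
  have h : u ∈ slitPlane := Or.inl hu
  exact (by fun_prop : DifferentiableAt ℂ (fun u => cexp (u ^ 2)) u).mul
    (differentiableAt_id.cpow_const h)

lemma tendsto_horizontal_hankelIntegrand {a q : ℝ} (ha : 0 < a) (hq : 0 < q) (ε : ℝ)
    (hε : |ε| = 1) :
    Tendsto (fun T : ℝ => ∫ x in (0 : ℝ)..a, hankelIntegrand q (x + (ε * T : ℝ) * I))
      atTop (𝓝 0) := by
  have hlim : Tendsto (fun T : ℝ => Real.exp (a ^ 2 + a) * ((a + T) ^ q * Real.exp (-1 * (a + T))) * a)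
      atTop (𝓝 (Real.exp (a ^ 2 + a) * 0 * a)) := by
    refine Tendsto.mul_const _ (Tendsto.const_mul _ ?_)
    exact (tendsto_rpow_mul_exp_neg_mul_atTop_nhds_zero q 1 one_pos).comp
      (tendsto_atTop_add_const_left _ a tendsto_id)
  rw [mul_zero, zero_mul] at hlim
  refine squeeze_zero_norm' ?_ hlim
  filter_upwards [eventually_ge_atTop 1] with T hT
  have hb : ∀ x ∈ Set.uIoc 0 a, ‖hankelIntegrand q (x + (ε * T : ℝ) * I)‖ ≤
      Real.exp (a ^ 2 + a) * ((a + T) ^ q * Real.exp (-1 * (a + T))) := by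
    intro x hx
    rw [Set.uIoc_of_le ha.le] at hx
    have hx0 := hx.1
    have hxa := hx.2
    have hε2 : (ε * T) ^ 2 = T ^ 2 := by rw [mul_pow, ← sq_abs ε, hε]; ring
    have hn : ‖verticalLine x (ε * T)‖ ≤ a + T := by
      refine abs_le_of_sq_le_sq' ?_ (by linarith) |>.2
      rw [norm_verticalLine_sq, hε2]; nlinarith
    have := norm_hankelIntegrand q x (ε * T)
    rw [verticalLine] at this
    rw [this, hε2]
    calc _ ≤ Real.exp (a ^ 2 - T) * (a + T) ^ q := by
          gcongr
          · nlinarith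
          · exact hn
      _ = _ := by
        rw [mul_comm ((a + T) ^ q), ← mul_assoc, ← Real.exp_add]
        ring_nf
  calc _ ≤ Real.exp (a ^ 2 + a) * ((a + T) ^ q * Real.exp (-1 * (a + T))) * |a - 0| :=
        intervalIntegral.norm_integral_le_of_norm_le_const hb
    _ = _ := by rw [sub_zero, abs_of_pos ha]

lemma integral_hankelIntegrand_eq_zero_line {a q : ℝ} (ha : 0 < a) (hq : 0 < q) :
    ∫ y, hankelIntegrand q (verticalLine a y) = ∫ y, hankelIntegrand q (verticalLine 0 y) := by
  have hrect : ∀ T : ℝ, (∫ y in -T..T, hankelIntegrand q (verticalLine a y)) =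
      (∫ y in -T..T, hankelIntegrand q (verticalLine 0 y)) +
      I * ((∫ x in (0 : ℝ)..a, hankelIntegrand q (x + ((-1) * T : ℝ) * I)) -
        ∫ x in (0 : ℝ)..a, hankelIntegrand q (x + (1 * T : ℝ) * I)) := by
    intro T
    have h := Complex.integral_boundary_rect_eq_zero_of_continuousOn_of_differentiableOn
      (hankelIntegrand q) (verticalLine 0 (-T)) (verticalLine a T) ?_ ?_
    · simp only [verticalLine_re, verticalLine_im, smul_eq_mul] at h
      simp only [verticalLine, one_mul, neg_mul]
      linear_combination (-I) * h + ((∫ y in -T..T, hankelIntegrand q (a + y * I)) -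
        ∫ y in -T..T, hankelIntegrand q ((0 : ℝ) + y * I)) * I_mul_I
    · intro u hu
      rw [verticalLine_re, verticalLine_re, Set.uIcc_of_le ha.le] at hu
      have hre : 0 ≤ u.re := hu.1.1
      refine ContinuousAt.continuousWithinAt ?_
      exact (by fun_prop : Continuous fun u : ℂ => cexp (u ^ 2)).continuousAt.mul
        (continuousAt_cpow_ofReal (Or.inr ⟨hq, hre⟩))
    · intro u hu
      rw [verticalLine_re, verticalLine_re, min_eq_left ha.le, max_eq_right ha.le] at hu
      exact (differentiableAt_hankelIntegrand q hu.1.1).differentiableWithinAt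
  have h1 := intervalIntegral_tendsto_integral
    (integrable_hankelIntegrand (a := a) (q := q) (Or.inl ha)) tendsto_neg_atTop_atBot tendsto_id
  have h0 := intervalIntegral_tendsto_integral
    (integrable_hankelIntegrand (a := 0) (q := q) (Or.inr ⟨hq, le_rfl⟩))
    tendsto_neg_atTop_atBot tendsto_id
  have h2 := h0.add (((tendsto_horizontal_hankelIntegrand ha hq (-1) (by norm_num)).sub
    (tendsto_horizontal_hankelIntegrand ha hq 1 (by norm_num))).const_mul I)
  rw [sub_zero, mul_zero, add_zero] at h2
  refine tendsto_nhds_unique h1 (h2.congr fun T => ?_)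
  exact (hrect T).symm

lemma integral_hankelIntegrand_recurrence {a : ℝ} (ha : 0 < a) (s : ℝ) :
    ∫ y, hankelIntegrand (1 - 2 * s) (verticalLine a y) =
      s * ∫ y, hankelIntegrand (1 - 2 * (s + 1)) (verticalLine a y) := by
  have i1 := integrable_hankelIntegrand (a := a) (q := 1 - 2 * s) (Or.inl ha)
  have i2 := integrable_hankelIntegrand (a := a) (q := 1 - 2 * (s + 1)) (Or.inl ha)
  have i3 := integrable_hankelIntegrand (a := a) (q := -2 * s) (Or.inl ha)
  have hd : ∀ y, HasDerivAt (fun y => hankelIntegrand (-2 * s) (verticalLine a y))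
      ((2 * I) * (hankelIntegrand (1 - 2 * s) (verticalLine a y) -
        s * hankelIntegrand (1 - 2 * (s + 1)) (verticalLine a y))) y := by
    intro y
    have hv := hasDerivAt_verticalLine a y
    have h := ((hv.pow 2).cexp).mul
      (hasDerivAt_verticalLine_cpow ha ((-2 * s : ℝ) : ℂ) y)
    refine h.congr_deriv ?_
    have hne := verticalLine_ne_zero ha y
    have e1 : (verticalLine a y) ^ ((1 - 2 * s : ℝ) : ℂ) =
        verticalLine a y * verticalLine a y ^ ((-2 * s : ℝ) : ℂ) := by
      rw [show ((1 - 2 * s : ℝ) : ℂ) = 1 + ((-2 * s : ℝ) : ℂ) by push_cast; ring,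
        cpow_add _ _ hne, cpow_one]
    have e2 : ((1 - 2 * (s + 1) : ℝ) : ℂ) = ((-2 * s : ℝ) : ℂ) - 1 := by push_cast; ring
    simp only [hankelIntegrand, e1, e2, Pi.pow_apply]
    push_cast
    ring
  have h0 := integral_eq_zero_of_hasDerivAt_of_integrable hd
    ((i1.sub (i2.const_mul _)).const_mul _) i3
  rw [integral_const_mul, integral_sub i1 (i2.const_mul _), integral_const_mul] at h0
  have := (mul_eq_zero.1 h0).resolve_left (by simp)
  exact sub_eq_zero.1 this

lemma continuous_integral_hankelIntegrand {a : ℝ} (ha : 0 < a) :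
    Continuous fun s : ℝ => ∫ y, hankelIntegrand (1 - 2 * s) (verticalLine a y) := by
  refine continuous_iff_continuousAt.2 fun s₀ => ?_
  have hint : ∀ q : ℝ, Integrable fun y => ‖hankelIntegrand q (verticalLine a y)‖ :=
    fun q => (integrable_hankelIntegrand (Or.inl ha)).norm
  refine continuousAt_of_dominated (bound := fun y =>
    ‖hankelIntegrand (1 - 2 * (s₀ - 1)) (verticalLine a y)‖ +
    ‖hankelIntegrand (1 - 2 * (s₀ + 1)) (verticalLine a y)‖) ?_ ?_ ((hint _).add (hint _)) ?_
  · exact Eventually.of_forall fun s =>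
      (continuous_hankelIntegrand (Or.inl ha)).aestronglyMeasurable
  · filter_upwards [Ioo_mem_nhds (sub_one_lt s₀) (lt_add_one s₀)] with s hs
    refine ae_of_all _ fun y => ?_
    have hn : 0 < ‖verticalLine a y‖ := norm_pos_iff.2 (verticalLine_ne_zero ha y)
    rw [norm_hankelIntegrand, norm_hankelIntegrand, norm_hankelIntegrand, ← mul_add]
    refine mul_le_mul_of_nonneg_left ?_ (Real.exp_nonneg _)
    rcases le_total 1 ‖verticalLine a y‖ with h | h
    · have := Real.rpow_le_rpow_of_exponent_le h
        (show 1 - 2 * s ≤ 1 - 2 * (s₀ - 1) by linarith [hs.1])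
      have h2 : 0 ≤ ‖verticalLine a y‖ ^ (1 - 2 * (s₀ + 1)) := by positivity
      linarith
    · have := Real.rpow_le_rpow_of_exponent_ge hn h
        (show 1 - 2 * (s₀ + 1) ≤ 1 - 2 * s by linarith [hs.2])
      have h2 : 0 ≤ ‖verticalLine a y‖ ^ (1 - 2 * (s₀ - 1)) := by positivity
      linarith
  · refine ae_of_all _ fun y => ?_
    unfold hankelIntegrand
    refine ContinuousAt.mul continuousAt_const ?_
    refine ContinuousAt.const_cpow ?_ (Or.inl (verticalLine_ne_zero ha y))
    fun_prop

lemma continuous_inv_Gamma_ofReal : Continuous fun s : ℝ => ((Real.Gamma s : ℂ))⁻¹ := by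
  simp_rw [← Complex.Gamma_ofReal]
  exact Complex.differentiable_one_div_Gamma.continuous.comp continuous_ofReal

/-- Hankel's formula for `1 / Γ`, with the contour deformed to the parabola `u ^ 2`, `Re u = a`. -/
lemma integral_hankelIntegrand {a : ℝ} (ha : 0 < a) (s : ℝ) :
    ∫ y, hankelIntegrand (1 - 2 * s) (verticalLine a y) = Real.pi * (Real.Gamma s : ℂ)⁻¹ := by
  have key : ∀ n : ℕ, ∀ s : ℝ, s < 1 / 2 + n →
      ∫ y, hankelIntegrand (1 - 2 * s) (verticalLine a y) = Real.pi * (Real.Gamma s : ℂ)⁻¹ := by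
    intro n
    induction n with
    | zero =>
      intro s hs
      have hs : s < 1 / 2 := by simpa using hs
      rw [integral_hankelIntegrand_eq_zero_line ha (by linarith), integral_hankelIntegrand_zero hs]
    | succ n ih =>
      have hne : ∀ s : ℝ, s < 1 / 2 + (n + 1 : ℕ) → s ≠ 1 →
          ∫ y, hankelIntegrand (1 - 2 * s) (verticalLine a y) =
            Real.pi * (Real.Gamma s : ℂ)⁻¹ := by
        intro s hs h1
        have h1' : s - 1 ≠ 0 := sub_ne_zero.2 h1
        have hc : ((s - 1 : ℝ) : ℂ) ≠ 0 := ofReal_ne_zero.2 h1'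
        have hrec := integral_hankelIntegrand_recurrence ha (s - 1)
        rw [ih (s - 1) (by push_cast at hs; linarith), sub_add_cancel] at hrec
        have hG := Real.Gamma_add_one h1'
        rw [sub_add_cancel] at hG
        rw [hG]
        push_cast at hrec hc ⊢
        rw [mul_inv]
        field_simp
        rw [← div_eq_mul_inv] at hrec
        linear_combination -hrec
      intro s hs
      by_cases h1 : s = 1
      · subst h1
        have hmem : ∀ᶠ s : ℝ in 𝓝[≠] 1, s < 1 / 2 + (n + 1 : ℕ) :=
          nhdsWithin_le_nhds (Iio_mem_nhds hs)
        have t1 := ((continuous_integral_hankelIntegrand ha).tendsto 1).mono_left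
          (nhdsWithin_le_nhds (s := {1}ᶜ))
        have t2 := ((continuous_inv_Gamma_ofReal.const_mul (Real.pi : ℂ)).tendsto 1).mono_left
          (nhdsWithin_le_nhds (s := {1}ᶜ))
        refine tendsto_nhds_unique t1 (t2.congr' ?_)
        filter_upwards [hmem, self_mem_nhdsWithin] with s h h'
        exact (hne s h h').symm
      · exact hne s hs h1
  obtain ⟨n, hn⟩ := exists_nat_gt s
  exact key n s (by linarith)

lemma verticalLine_cpow_mul_natCast {a : ℝ} (ha : 0 < a) (q p y : ℝ) (k : ℕ) :
    verticalLine a y ^ ((q + p * k : ℝ) : ℂ) =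
      verticalLine a y ^ (q : ℂ) * (verticalLine a y ^ (p : ℂ)) ^ k := by
  rw [← cpow_mul_nat, ← cpow_add _ _ (verticalLine_ne_zero ha y)]
  push_cast
  rfl

/-- Integral representation of the Wright function over the parabola `u ^ 2`, `Re u = a`. -/
lemma integral_eq_wrightR {ρ : ℝ} (h1 : -1 < ρ) (h0 : ρ < 0) (μ x : ℝ) {a : ℝ} (ha : 0 < a) :
    ∫ y, cexp (verticalLine a y ^ 2 - x * verticalLine a y ^ ((-2 * ρ : ℝ) : ℂ)) *
      verticalLine a y ^ ((1 - 2 * μ : ℝ) : ℂ) = Real.pi * (wrightR ρ μ (-x) : ℂ) := by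
  have hexpC : ∀ z : ℂ, HasSum (fun k : ℕ => z ^ k / (k.factorial : ℂ)) (cexp z) := fun z => by
    rw [Complex.exp_eq_exp_ℂ]; exact NormedSpace.expSeries_div_hasSum_exp z
  have hexpR : ∀ z : ℝ, HasSum (fun k : ℕ => z ^ k / (k.factorial : ℝ)) (Real.exp z) := fun z => by
    rw [Real.exp_eq_exp_ℝ]; exact NormedSpace.expSeries_div_hasSum_exp z
  have hb : ∀ y, HasSum (fun k : ℕ => Real.exp (a ^ 2 - y ^ 2) * (‖verticalLine a y‖ ^ (1 - 2 * μ) *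
      ((|x| * ‖verticalLine a y‖ ^ (-2 * ρ)) ^ k / (k.factorial : ℝ))))
      (Real.exp (a ^ 2 - y ^ 2) * (‖verticalLine a y‖ ^ (1 - 2 * μ) *
        Real.exp (|x| * ‖verticalLine a y‖ ^ (-2 * ρ)))) := fun y =>
    ((hexpR _).mul_left _).mul_left _
  have hsplit : ∀ (k : ℕ) (y : ℝ), hankelIntegrand (1 - 2 * (ρ * k + μ)) (verticalLine a y) =
      cexp (verticalLine a y ^ 2) * (verticalLine a y ^ ((1 - 2 * μ : ℝ) : ℂ) *
        (verticalLine a y ^ ((-2 * ρ : ℝ) : ℂ)) ^ k) := by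
    intro k y
    rw [← verticalLine_cpow_mul_natCast ha, hankelIntegrand]
    congr 4; ring
  have hsum := hasSum_integral_of_dominated_convergence (μ := (volume : Measure ℝ))
    (F := fun (k : ℕ) y => ((-x : ℝ) : ℂ) ^ k / (k.factorial : ℂ) *
      hankelIntegrand (1 - 2 * (ρ * k + μ)) (verticalLine a y))
    (f := fun y => cexp (verticalLine a y ^ 2 - x * verticalLine a y ^ ((-2 * ρ : ℝ) : ℂ)) *
      verticalLine a y ^ ((1 - 2 * μ : ℝ) : ℂ))
    (fun (k : ℕ) y => Real.exp (a ^ 2 - y ^ 2) * (‖verticalLine a y‖ ^ (1 - 2 * μ) *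
      ((|x| * ‖verticalLine a y‖ ^ (-2 * ρ)) ^ k / (k.factorial : ℝ)))) ?_ ?_ ?_ ?_ ?_
  · have hterm : ∀ k : ℕ, ∫ y, ((-x : ℝ) : ℂ) ^ k / (k.factorial : ℂ) *
        hankelIntegrand (1 - 2 * (ρ * k + μ)) (verticalLine a y) =
        Real.pi * (((-x) ^ k / ((k.factorial : ℝ) * Real.Gamma (ρ * (k : ℝ) + μ)) : ℝ) : ℂ) := by
      intro k
      rw [integral_const_mul, integral_hankelIntegrand ha]
      push_cast
      rw [div_eq_mul_inv, div_eq_mul_inv, mul_inv]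
      ring
    simp_rw [hterm] at hsum
    rw [← hsum.tsum_eq, tsum_mul_left, ← Complex.ofReal_tsum, wrightR]
  · exact fun k => ((continuous_hankelIntegrand (Or.inl ha)).const_mul _).aestronglyMeasurable
  · refine fun k => ae_of_all _ fun y => le_of_eq ?_
    rw [hsplit, norm_mul, norm_mul, norm_mul, norm_cexp_verticalLine_sq, norm_pow, norm_div,
      norm_pow, Complex.norm_cpow_real, Complex.norm_cpow_real, Complex.norm_real, norm_neg,
      Real.norm_eq_abs, Complex.norm_natCast, mul_pow]
    ring
  · exact ae_of_all _ fun y => (hb y).summable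
  · simp_rw [fun y => (hb y).tsum_eq]
    exact integrable_gaussian_mul_weight (Or.inl ha) (by linarith) (by linarith)
  · refine ae_of_all _ fun y => ?_
    have h := ((hexpC (-x * verticalLine a y ^ ((-2 * ρ : ℝ) : ℂ))).mul_left
      (cexp (verticalLine a y ^ 2))).mul_right (verticalLine a y ^ ((1 - 2 * μ : ℝ) : ℂ))
    rw [← Complex.exp_add, neg_mul, ← sub_eq_add_neg] at h
    refine h.congr_fun fun k => ?_
    rw [hsplit, ← neg_mul, mul_pow]
    push_cast
    ring

lemma norm_le_of_norm_deriv_le_pow {f f' : ℝ → ℂ} {K y : ℝ} (n : ℕ)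
    (hf : ∀ t, HasDerivAt f (f' t) t) (h0 : f 0 = 0)
    (hb : ∀ s ∈ Set.Icc (0 : ℝ) 1, ‖f' (s * y)‖ ≤ K * |s * y| ^ n) :
    ‖f y‖ ≤ K * |y| ^ (n + 1) / (n + 1) := by
  have hφ : ∀ s : ℝ, HasDerivAt (fun s => f (s * y)) (y • f' (s * y)) s := fun s => by
    have := (hf (s * y)).scomp s ((hasDerivAt_id s).mul_const y)
    refine this.congr_deriv ?_
    rw [one_mul]
  have hB : ∀ s : ℝ, HasDerivAt (fun s : ℝ => K * |y| ^ (n + 1) / (n + 1) * s ^ (n + 1))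
      (K * |y| ^ (n + 1) * s ^ n) s := fun s => by
    refine ((hasDerivAt_pow (n + 1) s).const_mul _).congr_deriv ?_
    have : (n : ℝ) + 1 ≠ 0 := by positivity
    push_cast
    field_simp
  have := image_norm_le_of_norm_deriv_right_le_deriv_boundary (f := fun s => f (s * y))
    (f' := fun s => y • f' (s * y)) (a := 0) (b := 1)
    (fun s _ => (hφ s).continuousAt.continuousWithinAt)
    (fun s _ => (hφ s).hasDerivWithinAt) (B := fun s : ℝ => K * |y| ^ (n + 1) / (n + 1) * s ^ (n + 1))
    (B' := fun s => K * |y| ^ (n + 1) * s ^ n) (by simp [h0]) hB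
    (fun s hs => by
      rw [norm_smul, Real.norm_eq_abs]
      have h := hb s (Set.Ico_subset_Icc_self hs)
      rw [abs_mul, abs_of_nonneg hs.1] at h
      calc _ ≤ |y| * (K * (s * |y|) ^ n) := by gcongr
        _ = _ := by ring) (Set.right_mem_Icc.2 zero_le_one)
  simpa using this

lemma norm_cexp_sub_one_sub_id_le (w : ℂ) :
    ‖cexp w - 1 - w‖ ≤ ‖w‖ ^ 2 / 2 * (1 + Real.exp w.re) := by
  have hd : ∀ t : ℝ, HasDerivAt (fun t : ℝ => (t : ℂ) * w) w t := fun t => by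
    have h := (Complex.ofRealCLM.hasDerivAt (x := t)).mul_const w
    rw [ofRealCLM_apply, ofReal_one, one_mul] at h
    exact h
  have h1 : ∀ s ∈ Set.Icc (0 : ℝ) 1, ‖cexp ((s : ℂ) * w)‖ ≤ 1 + Real.exp w.re := by
    intro s hs
    rw [Complex.norm_exp, Complex.re_ofReal_mul]
    rcases le_total 0 w.re with h | h
    · have : Real.exp (s * w.re) ≤ Real.exp w.re := by
        gcongr; nlinarith [hs.2]
      linarith
    · have : Real.exp (s * w.re) ≤ 1 := Real.exp_le_one_iff.2 (mul_nonpos_of_nonneg_of_nonpos hs.1 h)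
      linarith [Real.exp_pos w.re]
  have h2 : ∀ s ∈ Set.Icc (0 : ℝ) 1, ‖cexp ((s : ℂ) * w) - 1‖ ≤ ‖w‖ * (1 + Real.exp w.re) * |s| := by
    intro s hs
    have := norm_le_of_norm_deriv_le_pow (f := fun t : ℝ => cexp ((t : ℂ) * w) - 1) (y := s)
      (K := ‖w‖ * (1 + Real.exp w.re)) 0
      (fun t => ((hd t).cexp.sub_const 1)) (by simp) (fun t ht => by
        rw [norm_mul, pow_zero, mul_one, mul_comm]
        refine mul_le_mul_of_nonneg_left (h1 _ ⟨mul_nonneg ht.1 hs.1, ?_⟩) (norm_nonneg _)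
        exact mul_le_one₀ ht.2 hs.1 hs.2)
    simpa using this
  have := norm_le_of_norm_deriv_le_pow (f := fun t : ℝ => cexp ((t : ℂ) * w) - 1 - t * w) (y := 1)
      (K := ‖w‖ ^ 2 * (1 + Real.exp w.re)) 1
      (fun t => ((hd t).cexp.sub_const 1).sub (hd t)) (by simp) (fun t ht => by
        rw [mul_one]
        calc ‖cexp (t * w) * w - w‖ = ‖w‖ * ‖cexp (t * w) - 1‖ := by
              rw [← norm_mul]; congr 1; ring
          _ ≤ ‖w‖ * (‖w‖ * (1 + Real.exp w.re) * |t|) := by gcongr; exact h2 t ht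
          _ = _ := by ring)
  simp only [ofReal_one, one_mul, abs_one, one_pow, mul_one] at this
  calc _ ≤ _ := this
    _ = _ := by push_cast; ring

lemma norm_verticalLine_cpow_le {c : ℝ} (M : ℕ) (hc : c ≤ 2 * M) {t y : ℝ} (h : |t| ≤ |y|) :
    ‖verticalLine 1 t ^ (c : ℂ)‖ ≤ (1 + y ^ 2) ^ M := by
  rw [Complex.norm_cpow_real]
  calc _ ≤ ‖verticalLine 1 t‖ ^ ((2 * M : ℕ) : ℝ) :=
        Real.rpow_le_rpow_of_exponent_le (le_norm_verticalLine 1 t) (by push_cast; exact hc)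
    _ = (1 + t ^ 2) ^ M := by rw [Real.rpow_natCast, pow_mul, norm_verticalLine_sq, one_pow]
    _ ≤ _ := by
      have := sq_le_sq.2 h
      gcongr

lemma verticalLine_one_zero : verticalLine 1 0 = 1 := by simp [verticalLine]

lemma abs_mul_le_abs {s : ℝ} (hs : s ∈ Set.Icc (0 : ℝ) 1) (y : ℝ) : |s * y| ≤ |y| := by
  rw [abs_mul, abs_of_nonneg hs.1]
  exact mul_le_of_le_one_left (abs_nonneg y) hs.2

lemma hasDerivAt_verticalLine_one_cpow (c y : ℝ) :
    HasDerivAt (fun y => verticalLine 1 y ^ (c : ℂ))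
      (I * c * verticalLine 1 y ^ ((c - 1 : ℝ) : ℂ)) y := by
  have := hasDerivAt_verticalLine_cpow one_pos (c : ℂ) y
  push_cast
  exact this

lemma hasDerivAt_ofReal_pow (n : ℕ) (y : ℝ) :
    HasDerivAt (fun y : ℝ => (y : ℂ) ^ n) (n * (y : ℂ) ^ (n - 1)) y := by
  simpa using (hasDerivAt_pow n (y : ℂ)).comp_ofReal

lemma norm_I_mul_ofReal (c : ℝ) : ‖I * (c : ℂ)‖ = |c| := by
  rw [norm_mul, norm_I, one_mul, Complex.norm_real, Real.norm_eq_abs]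

lemma norm_verticalLine_cpow_sub_one_le (M : ℕ) {c : ℝ} (hc : c ≤ 2 * M + 1) (y : ℝ) :
    ‖verticalLine 1 y ^ (c : ℂ) - 1‖ ≤ |c| * (1 + y ^ 2) ^ M * |y| := by
  have := norm_le_of_norm_deriv_le_pow (y := y) (K := |c| * (1 + y ^ 2) ^ M) 0
    (fun t => (hasDerivAt_verticalLine_one_cpow c t).sub_const 1)
    (by simp [verticalLine_one_zero]) (fun s hs => by
      rw [norm_mul, norm_mul, norm_I, Complex.norm_real, one_mul, Real.norm_eq_abs, pow_zero,
        mul_one]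
      gcongr
      exact norm_verticalLine_cpow_le M (by linarith) (abs_mul_le_abs hs y))
  simpa using this

lemma norm_verticalLine_cpow_sub_taylor_one_le (M : ℕ) {c : ℝ} (hc : c ≤ 2 * M + 2) (y : ℝ) :
    ‖verticalLine 1 y ^ (c : ℂ) - 1 - I * c * y‖ ≤ |c * (c - 1)| * (1 + y ^ 2) ^ M * y ^ 2 / 2 := by
  have hd (t : ℝ) := ((hasDerivAt_verticalLine_one_cpow c t).sub_const 1).sub
    ((hasDerivAt_ofReal_pow 1 t).const_mul (I * c))
  have := norm_le_of_norm_deriv_le_pow (y := y) (K := |c * (c - 1)| * (1 + y ^ 2) ^ M) 1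
    hd (by simp [verticalLine_one_zero]) (fun s hs => by
      have h := norm_verticalLine_cpow_sub_one_le M (c := c - 1) (by linarith) (s * y)
      have h2 : (1 + (s * y) ^ 2) ^ M ≤ (1 + y ^ 2) ^ M := by
        have := sq_le_sq.2 (abs_mul_le_abs hs y)
        gcongr
      calc _ = |c| * ‖verticalLine 1 (s * y) ^ ((c - 1 : ℝ) : ℂ) - 1‖ := by
            rw [← norm_I_mul_ofReal c, ← norm_mul]
            congr 1; simp; ring
        _ ≤ |c| * (|c - 1| * (1 + y ^ 2) ^ M * |s * y|) := by
            gcongr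
            exact h.trans (by gcongr)
        _ = _ := by rw [abs_mul c]; ring)
  simp only [pow_one, Nat.cast_one, sq_abs, Nat.reduceAdd] at this
  rwa [one_add_one_eq_two] at this

lemma norm_verticalLine_cpow_sub_taylor_two_le {c : ℝ} (hc : c ≤ 3) (y : ℝ) :
    ‖verticalLine 1 y ^ (c : ℂ) - 1 - I * c * y + c * (c - 1) / 2 * y ^ 2‖ ≤
      |c * (c - 1) * (c - 2)| * |y| ^ 3 / 6 := by
  have hd (t : ℝ) := (((hasDerivAt_verticalLine_one_cpow c t).sub_const 1).sub
    ((hasDerivAt_ofReal_pow 1 t).const_mul (I * c))).add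
    ((hasDerivAt_ofReal_pow 2 t).const_mul ((c : ℂ) * (c - 1) / 2))
  have := norm_le_of_norm_deriv_le_pow (y := y) (K := |c * (c - 1) * (c - 2)| / 2) 2
    hd (by simp [verticalLine_one_zero]) (fun s hs => by
      have h := norm_verticalLine_cpow_sub_taylor_one_le 0 (c := c - 1) (by norm_num; linarith) (s * y)
      calc _ = |c| * ‖verticalLine 1 (s * y) ^ ((c - 1 : ℝ) : ℂ) - 1 -
              I * (c - 1 : ℝ) * (s * y : ℝ)‖ := by
            rw [← norm_I_mul_ofReal c, ← norm_mul]
            congr 1; push_cast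
            linear_combination ((c : ℂ) * (c - 1) * (s * y)) * I_mul_I
        _ ≤ |c| * (|(c - 1) * (c - 1 - 1)| * (1 + (s * y) ^ 2) ^ 0 * (s * y) ^ 2 / 2) := by gcongr
        _ = _ := by
          rw [abs_mul, abs_mul, abs_mul c, sq_abs, show c - 1 - 1 = c - 2 by ring]; ring)
  simp only [pow_one, Nat.cast_ofNat, Nat.reduceAdd] at this
  refine this.trans (le_of_eq ?_)
  ring

lemma norm_verticalLine_cpow_sub_taylor_three_le {c : ℝ} (hc : c ≤ 4) (y : ℝ) :
    ‖verticalLine 1 y ^ (c : ℂ) - 1 - I * c * y + c * (c - 1) / 2 * y ^ 2 +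
        I * (c * (c - 1) * (c - 2) / 6) * y ^ 3‖ ≤
      |c * (c - 1) * (c - 2) * (c - 3)| * y ^ 4 / 24 := by
  have hd (t : ℝ) := ((((hasDerivAt_verticalLine_one_cpow c t).sub_const 1).sub
    ((hasDerivAt_ofReal_pow 1 t).const_mul (I * c))).add
    ((hasDerivAt_ofReal_pow 2 t).const_mul ((c : ℂ) * (c - 1) / 2))).add
    ((hasDerivAt_ofReal_pow 3 t).const_mul (I * ((c : ℂ) * (c - 1) * (c - 2) / 6)))
  have := norm_le_of_norm_deriv_le_pow (y := y) (K := |c * (c - 1) * (c - 2) * (c - 3)| / 6) 3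
    hd (by simp [verticalLine_one_zero]) (fun s hs => by
      have h := norm_verticalLine_cpow_sub_taylor_two_le (c := c - 1) (by linarith) (s * y)
      calc _ = |c| * ‖verticalLine 1 (s * y) ^ ((c - 1 : ℝ) : ℂ) - 1 -
              I * (c - 1 : ℝ) * (s * y : ℝ) +
              (c - 1 : ℝ) * ((c - 1 : ℝ) - 1) / 2 * (s * y : ℝ) ^ 2‖ := by
            rw [← norm_I_mul_ofReal c, ← norm_mul]
            congr 1; push_cast
            linear_combination ((c : ℂ) * (c - 1) * (s * y)) * I_mul_I
        _ ≤ |c| * (|(c - 1) * (c - 1 - 1) * (c - 1 - 2)| * |s * y| ^ 3 / 6) := by gcongr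
        _ = _ := by
          rw [abs_mul, abs_mul, abs_mul _ (c - 3), abs_mul _ (c - 2), abs_mul c,
            show c - 1 - 1 = c - 2 by ring, show c - 1 - 2 = c - 3 by ring]; ring)
  simp only [pow_one, Nat.cast_ofNat, Nat.reduceAdd] at this
  refine this.trans (le_of_eq ?_)
  rw [show |y| ^ 4 = y ^ 4 from Even.pow_abs (by decide) y]
  ring

lemma one_add_sq_pow_le_exp (n : ℕ) {κ : ℝ} (hκ : 0 < κ) (z : ℝ) :
    (1 + z ^ 2) ^ n ≤ (n.factorial * (2 / κ) ^ n * Real.exp (κ / 2)) * Real.exp (κ / 2 * z ^ 2) := by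
  have h := Real.pow_div_factorial_le_exp (κ / 2 * (1 + z ^ 2)) (by positivity) n
  rw [div_le_iff₀ (by positivity), mul_pow] at h
  rw [mul_assoc, ← Real.exp_add]
  calc (1 + z ^ 2) ^ n = (2 / κ) ^ n * ((κ / 2) ^ n * (1 + z ^ 2) ^ n) := by
        rw [← mul_assoc, ← mul_pow]
        field_simp
        simp
    _ ≤ (2 / κ) ^ n * (Real.exp (κ / 2 * (1 + z ^ 2)) * n.factorial) := by gcongr
    _ = _ := by ring_nf

lemma integrable_one_add_sq_pow_mul_exp (n : ℕ) {κ : ℝ} (hκ : 0 < κ) :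
    Integrable fun z : ℝ => (1 + z ^ 2) ^ n * Real.exp (-κ * z ^ 2) := by
  refine ((integrable_exp_neg_mul_sq (half_pos hκ)).const_mul
    (n.factorial * (2 / κ) ^ n * Real.exp (κ / 2))).mono' ?_ (ae_of_all _ fun z => ?_)
  · exact Continuous.aestronglyMeasurable (by fun_prop)
  · rw [Real.norm_of_nonneg (by positivity)]
    calc _ ≤ (n.factorial * (2 / κ) ^ n * Real.exp (κ / 2)) * Real.exp (κ / 2 * z ^ 2) *
          Real.exp (-κ * z ^ 2) := by
          gcongr; exact one_add_sq_pow_le_exp n hκ z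
      _ = _ := by
        rw [mul_assoc (_ * _), ← Real.exp_add]
        ring_nf

lemma integral_gaussian_mul_odd {m : ℝ} (hm : 0 < m) (α β : ℂ) :
    Integrable (fun z : ℝ => (Real.exp (-m * z ^ 2) : ℂ) * (1 + α * z ^ 3 + β * z)) ∧
    ∫ z : ℝ, (Real.exp (-m * z ^ 2) : ℂ) * (1 + α * z ^ 3 + β * z) =
      ((√(Real.pi / m) : ℝ) : ℂ) := by
  have i0 : Integrable fun z : ℝ => (Real.exp (-m * z ^ 2) : ℂ) :=
    (integrable_exp_neg_mul_sq hm).ofReal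
  have i1 : Integrable fun z : ℝ => (Real.exp (-m * z ^ 2) : ℂ) * (α * z ^ 3 + β * z) := by
    refine ((integrable_one_add_sq_pow_mul_exp 2 hm).const_mul (‖α‖ + ‖β‖)).mono' ?_
      (ae_of_all _ fun z => ?_)
    · exact Continuous.aestronglyMeasurable (by fun_prop)
    · rw [norm_mul, Complex.norm_real, Real.norm_of_nonneg (Real.exp_nonneg _)]
      have h1 : |z| ≤ 1 + z ^ 2 := by rw [← sq_abs]; nlinarith [sq_nonneg (|z| - 1)]
      have h2 : ‖α * z ^ 3 + β * z‖ ≤ (‖α‖ + ‖β‖) * (1 + z ^ 2) ^ 2 := by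
        calc _ ≤ ‖α‖ * |z| ^ 3 + ‖β‖ * |z| := by
              refine (norm_add_le _ _).trans ?_
              simp
          _ ≤ ‖α‖ * (1 + z ^ 2) ^ 2 + ‖β‖ * (1 + z ^ 2) ^ 2 := by
              gcongr
              · calc |z| ^ 3 = |z| * z ^ 2 := by rw [← sq_abs z]; ring
                  _ ≤ (1 + z ^ 2) * (1 + z ^ 2) := by gcongr; linarith
                  _ = _ := by ring
              · nlinarith [sq_nonneg z]
          _ = _ := by ring
      calc _ ≤ Real.exp (-m * z ^ 2) * ((‖α‖ + ‖β‖) * (1 + z ^ 2) ^ 2) := by gcongr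
        _ = _ := by ring
  have hodd : ∫ z : ℝ, (Real.exp (-m * z ^ 2) : ℂ) * (α * z ^ 3 + β * z) = 0 := by
    have h := integral_neg_eq_self (fun z : ℝ => (Real.exp (-m * z ^ 2) : ℂ) * (α * z ^ 3 + β * z))
      volume
    have h2 : ∀ z : ℝ, (Real.exp (-m * (-z) ^ 2) : ℂ) * (α * (-z : ℝ) ^ 3 + β * (-z : ℝ)) =
        -((Real.exp (-m * z ^ 2) : ℂ) * (α * z ^ 3 + β * z)) := fun z => by
      rw [neg_sq]; push_cast; ring
    simp_rw [h2] at h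
    rw [integral_neg] at h
    exact self_eq_neg.1 h.symm
  have heq : (fun z : ℝ => (Real.exp (-m * z ^ 2) : ℂ) * (1 + α * z ^ 3 + β * z)) =
      fun z : ℝ => (Real.exp (-m * z ^ 2) : ℂ) + (Real.exp (-m * z ^ 2) : ℂ) * (α * z ^ 3 + β * z) := by
    funext z; ring
  rw [heq]
  refine ⟨i0.add i1, ?_⟩
  rw [integral_add i0 i1, hodd, add_zero, integral_complex_ofReal, integral_gaussian]

section Laplace

variable {D g : ℝ → ℂ} {m κ c K₃ K₄ B q : ℝ} {M : ℕ}

lemma laplace_pointwise_bound (hκm : κ ≤ m)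
    (hK₄ : 0 ≤ K₄) (hB : 0 ≤ B)
    (hD₃ : ∀ y : ℝ, ‖D y + m * y ^ 2‖ ≤ K₃ * |y| ^ 3)
    (hD₄ : ∀ y : ℝ, ‖D y + m * y ^ 2 - I * c * y ^ 3‖ ≤ K₄ * y ^ 4)
    (hre : ∀ y : ℝ, (D y).re ≤ -κ * y ^ 2)
    (hg₀ : ∀ y : ℝ, ‖g y‖ ≤ B * (1 + y ^ 2) ^ M)
    (hg₁ : ∀ y : ℝ, ‖g y - 1‖ ≤ B * (1 + y ^ 2) ^ M * |y|)
    (hg₂ : ∀ y : ℝ, ‖g y - 1 - I * q * y‖ ≤ B * (1 + y ^ 2) ^ M * y ^ 2)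
    {r : ℝ} (hr : 1 ≤ r) (z : ℝ) :
    ‖cexp ((r : ℂ) ^ 2 * D (z / r)) * g (z / r) -
      (Real.exp (-m * z ^ 2) : ℂ) * (1 + I * c / r * z ^ 3 + I * q / r * z)‖ ≤
      B * (K₃ ^ 2 + K₄ + |c| + 1) / r ^ 2 * ((1 + z ^ 2) ^ (M + 3) * Real.exp (-κ * z ^ 2)) := by
  have hr0 : 0 < r := by linarith
  have hrc : (r : ℂ) ≠ 0 := ofReal_ne_zero.2 hr0.ne'
  set y : ℝ := z / r with hy
  have hz : z = r * y := by rw [hy]; field_simp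
  set w : ℂ := (r : ℂ) ^ 2 * (D y + m * y ^ 2) with hw
  set e : ℝ := Real.exp (-m * z ^ 2) with he
  set e' : ℝ := Real.exp (-κ * z ^ 2) with he'
  set N : ℝ := (1 + y ^ 2) ^ M with hN
  have hN0 : 0 ≤ N := by positivity
  have he0 : 0 ≤ e := (Real.exp_pos _).le
  have hee : e ≤ e' := by
    rw [he, he']
    gcongr
  have hexp_nonneg : 0 ≤ e' := he0.trans hee
  have hyz : y ^ 2 ≤ z ^ 2 := by
    rw [hz, mul_pow]
    exact le_mul_of_one_le_left (sq_nonneg y) (one_le_pow₀ hr)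
  have hNz : N ≤ (1 + z ^ 2) ^ M := by rw [hN]; gcongr
  have hexp : cexp ((r : ℂ) ^ 2 * D y) = e * cexp w := by
    rw [he, ofReal_exp, ← Complex.exp_add, hw, hz]
    congr 1; push_cast; ring
  have hew : e * Real.exp w.re ≤ e' := by
    rw [he, he', ← Real.exp_add]
    have : w.re = r ^ 2 * ((D y).re + m * y ^ 2) := by
      rw [hw, ← ofReal_pow, Complex.re_ofReal_mul, Complex.add_re, ← ofReal_pow, ← ofReal_mul,
        ofReal_re]
    rw [this, hz]
    have := mul_le_mul_of_nonneg_left (hre y) (sq_nonneg r)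
    gcongr
    nlinarith
  have hwn : ‖w‖ ≤ r ^ 2 * (K₃ * |y| ^ 3) := by
    rw [hw, norm_mul, norm_pow, Complex.norm_real, Real.norm_of_nonneg hr0.le]
    gcongr; exact hD₃ y
  have t1 : ‖g y * (e * (cexp w - 1 - w))‖ ≤ B * N * (K₃ ^ 2 * (r ^ 4 * y ^ 6) * e') := by
    rw [norm_mul, norm_mul, Complex.norm_real, Real.norm_of_nonneg he0]
    have h1 : e * ‖cexp w - 1 - w‖ ≤ ‖w‖ ^ 2 * e' := by
      calc _ ≤ e * (‖w‖ ^ 2 / 2 * (1 + Real.exp w.re)) := by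
            gcongr; exact norm_cexp_sub_one_sub_id_le w
        _ = ‖w‖ ^ 2 / 2 * (e + e * Real.exp w.re) := by ring
        _ ≤ ‖w‖ ^ 2 / 2 * (e' + e') := by gcongr
        _ = _ := by ring
    have h2 : ‖w‖ ^ 2 ≤ K₃ ^ 2 * (r ^ 4 * y ^ 6) := by
      calc _ ≤ (r ^ 2 * (K₃ * |y| ^ 3)) ^ 2 := by gcongr
        _ = K₃ ^ 2 * (r ^ 4 * (|y| ^ 2) ^ 3) := by ring
        _ = _ := by rw [sq_abs]; ring
    have h3 : ‖w‖ ^ 2 * e' ≤ K₃ ^ 2 * (r ^ 4 * y ^ 6) * e' := by gcongr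
    exact mul_le_mul (hg₀ y) (h1.trans h3) (by positivity) (by positivity)
  have t2 : ‖g y * (e * (w - r ^ 2 * (I * c * y ^ 3)))‖ ≤ B * N * (K₄ * (r ^ 2 * y ^ 4) * e') := by
    rw [norm_mul, norm_mul, Complex.norm_real, Real.norm_of_nonneg he0]
    have h1 : ‖w - r ^ 2 * (I * c * y ^ 3)‖ ≤ K₄ * (r ^ 2 * y ^ 4) := by
      rw [hw, ← mul_sub, norm_mul, norm_pow, Complex.norm_real, Real.norm_of_nonneg hr0.le]
      calc _ ≤ r ^ 2 * (K₄ * y ^ 4) := by gcongr; exact hD₄ y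
        _ = _ := by ring
    have h2 : e * ‖w - r ^ 2 * (I * c * y ^ 3)‖ ≤ K₄ * (r ^ 2 * y ^ 4) * e' := by
      rw [mul_comm]
      exact mul_le_mul h1 hee he0 (by positivity)
    exact mul_le_mul (hg₀ y) h2 (by positivity) (by positivity)
  have t3 : ‖(e : ℂ) * (g y - 1 - I * q * y)‖ ≤ B * N * (y ^ 2 * e') := by
    rw [norm_mul, Complex.norm_real, Real.norm_of_nonneg he0]
    calc _ ≤ e' * (B * N * y ^ 2) := mul_le_mul hee (hg₂ y) (norm_nonneg _) hexp_nonneg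
      _ = _ := by ring
  have t4 : ‖(e : ℂ) * ((g y - 1) * (r ^ 2 * (I * c * y ^ 3)))‖ ≤
      B * N * (|c| * (r ^ 2 * y ^ 4) * e') := by
    have h1 : ‖(r : ℂ) ^ 2 * (I * c * y ^ 3)‖ = r ^ 2 * (|c| * |y| ^ 3) := by
      simp
    rw [norm_mul, norm_mul, Complex.norm_real, Real.norm_of_nonneg he0, h1]
    calc _ ≤ e' * (B * N * |y| * (r ^ 2 * (|c| * |y| ^ 3))) := by
          gcongr
          exact hg₁ y
      _ = B * N * (|c| * (r ^ 2 * (|y| ^ 2) ^ 2) * e') := by ring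
      _ = _ := by rw [sq_abs]; ring
  have hsplit : cexp ((r : ℂ) ^ 2 * D y) * g y -
      (e : ℂ) * (1 + I * c / r * z ^ 3 + I * q / r * z) =
      g y * (e * (cexp w - 1 - w)) + g y * (e * (w - r ^ 2 * (I * c * y ^ 3))) +
      (e : ℂ) * (g y - 1 - I * q * y) + (e : ℂ) * ((g y - 1) * (r ^ 2 * (I * c * y ^ 3))) := by
    rw [hexp, hz]
    push_cast
    field_simp
    ring
  rw [hsplit]
  have hpow : ∀ j : ℕ, j ≤ 3 → (z ^ 2) ^ j ≤ (1 + z ^ 2) ^ 3 := fun j hj =>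
    calc (z ^ 2) ^ j ≤ (1 + z ^ 2) ^ j := by gcongr; linarith
      _ ≤ _ := pow_le_pow_right₀ (by nlinarith [sq_nonneg z]) hj
  have p1 : y ^ 2 ≤ (1 + z ^ 2) ^ 3 / r ^ 2 := by
    rw [le_div_iff₀ (by positivity)]
    calc y ^ 2 * r ^ 2 = (z ^ 2) ^ 1 := by rw [hz]; ring
      _ ≤ _ := hpow 1 (by norm_num)
  have p2 : r ^ 2 * y ^ 4 ≤ (1 + z ^ 2) ^ 3 / r ^ 2 := by
    rw [le_div_iff₀ (by positivity)]
    calc r ^ 2 * y ^ 4 * r ^ 2 = (z ^ 2) ^ 2 := by rw [hz]; ring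
      _ ≤ _ := hpow 2 (by norm_num)
  have p3 : r ^ 4 * y ^ 6 ≤ (1 + z ^ 2) ^ 3 / r ^ 2 := by
    rw [le_div_iff₀ (by positivity)]
    calc r ^ 4 * y ^ 6 * r ^ 2 = (z ^ 2) ^ 3 := by rw [hz]; ring
      _ ≤ _ := hpow 3 le_rfl
  set P : ℝ := (1 + z ^ 2) ^ 3 / r ^ 2 with hP
  have hP0 : 0 ≤ P := by positivity
  calc _ ≤ B * N * (K₃ ^ 2 * (r ^ 4 * y ^ 6) * e') + B * N * (K₄ * (r ^ 2 * y ^ 4) * e') +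
        B * N * (y ^ 2 * e') + B * N * (|c| * (r ^ 2 * y ^ 4) * e') :=
        (norm_add_le _ _).trans (add_le_add ((norm_add_le _ _).trans
          (add_le_add ((norm_add_le _ _).trans (add_le_add t1 t2)) t3)) t4)
    _ ≤ B * N * (K₃ ^ 2 * P * e') + B * N * (K₄ * P * e') +
        B * N * (P * e') + B * N * (|c| * P * e') := by gcongr
    _ = B * N * (K₃ ^ 2 + K₄ + |c| + 1) * P * e' := by ring
    _ ≤ B * (1 + z ^ 2) ^ M * (K₃ ^ 2 + K₄ + |c| + 1) * P * e' := by gcongr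
    _ = _ := by rw [hP, pow_add]; ring

/-- Laplace's method on a steepest-descent line, with a relative error of the order of the
inverse square of the large parameter `r`. -/
lemma exists_laplace_bound (hκ : 0 < κ) (hκm : κ ≤ m)
    (hK₄ : 0 ≤ K₄) (hB : 0 ≤ B) (hDc : Continuous D) (hgc : Continuous g)
    (hD₃ : ∀ y : ℝ, ‖D y + m * y ^ 2‖ ≤ K₃ * |y| ^ 3)
    (hD₄ : ∀ y : ℝ, ‖D y + m * y ^ 2 - I * c * y ^ 3‖ ≤ K₄ * y ^ 4)
    (hre : ∀ y : ℝ, (D y).re ≤ -κ * y ^ 2)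
    (hg₀ : ∀ y : ℝ, ‖g y‖ ≤ B * (1 + y ^ 2) ^ M)
    (hg₁ : ∀ y : ℝ, ‖g y - 1‖ ≤ B * (1 + y ^ 2) ^ M * |y|)
    (hg₂ : ∀ y : ℝ, ‖g y - 1 - I * q * y‖ ≤ B * (1 + y ^ 2) ^ M * y ^ 2) :
    ∃ C, 0 ≤ C ∧ ∀ r : ℝ, 1 ≤ r →
      ‖(∫ z : ℝ, cexp ((r : ℂ) ^ 2 * D (z / r)) * g (z / r)) - ((√(Real.pi / m) : ℝ) : ℂ)‖ ≤
        C / r ^ 2 := by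
  have hG := integrable_one_add_sq_pow_mul_exp (M + 3) hκ
  refine ⟨B * (K₃ ^ 2 + K₄ + |c| + 1) * ∫ z : ℝ, (1 + z ^ 2) ^ (M + 3) * Real.exp (-κ * z ^ 2),
    mul_nonneg (by positivity) (integral_nonneg fun z => by positivity), fun r hr => ?_⟩
  have hpt := laplace_pointwise_bound hκm hK₄ hB hD₃ hD₄ hre hg₀ hg₁ hg₂ hr
  obtain ⟨hi, hv⟩ := integral_gaussian_mul_odd (hκ.trans_le hκm) (I * c / r) (I * q / r)
  have hdiff : Integrable fun z : ℝ => cexp ((r : ℂ) ^ 2 * D (z / r)) * g (z / r) -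
      (Real.exp (-m * z ^ 2) : ℂ) * (1 + I * c / r * z ^ 3 + I * q / r * z) :=
    (hG.const_mul _).mono' (Continuous.aestronglyMeasurable (by fun_prop))
      (ae_of_all _ hpt)
  have hF : Integrable fun z : ℝ => cexp ((r : ℂ) ^ 2 * D (z / r)) * g (z / r) :=
    (hdiff.add hi).congr (ae_of_all _ fun z => sub_add_cancel _ _)
  rw [← hv, ← integral_sub hF hi]
  calc _ ≤ ∫ z : ℝ, B * (K₃ ^ 2 + K₄ + |c| + 1) / r ^ 2 *
        ((1 + z ^ 2) ^ (M + 3) * Real.exp (-κ * z ^ 2)) :=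
        norm_integral_le_of_norm_le (hG.const_mul _) (ae_of_all _ hpt)
    _ = _ := by rw [integral_const_mul]; ring

end Laplace

/-- The exponent of the Wright integrand on the line through the saddle point, centred and
divided by its large parameter. -/
noncomputable def wrightPhase (p y : ℝ) : ℂ :=
  2 * I * y - y ^ 2 - 2 / p * (verticalLine 1 y ^ (p : ℂ) - 1)

lemma verticalLine_eq_mul {r : ℝ} (hr : 0 < r) (z : ℝ) :
    verticalLine r z = r * verticalLine 1 (z / r) := by
  have : (r : ℂ) ≠ 0 := ofReal_ne_zero.2 hr.ne'
  simp only [verticalLine]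
  push_cast
  field_simp

lemma verticalLine_cpow_eq_mul {r : ℝ} (hr : 0 < r) (z s : ℝ) :
    verticalLine r z ^ (s : ℂ) = ((r ^ s : ℝ) : ℂ) * verticalLine 1 (z / r) ^ (s : ℂ) := by
  rw [verticalLine_eq_mul hr, real_mul_cpow hr (verticalLine_ne_zero one_pos _),
    ofReal_cpow hr.le]

lemma exponent_eq_wrightPhase {p r x : ℝ} (hr : 0 < r)
    (hx : x * r ^ p = 2 / p * r ^ 2) (z : ℝ) :
    verticalLine r z ^ 2 - x * verticalLine r z ^ (p : ℂ) =
      ((r ^ 2 * (1 - 2 / p) : ℝ) : ℂ) + (r : ℂ) ^ 2 * wrightPhase p (z / r) := by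
  have hx' : (x : ℂ) * ((r ^ p : ℝ) : ℂ) = 2 / p * (r : ℂ) ^ 2 := by
    rw [← ofReal_mul, hx]; push_cast; rfl
  have hI : (verticalLine 1 (z / r)) ^ 2 = 1 + 2 * I * (z / r : ℝ) - (z / r : ℝ) ^ 2 := by
    simp only [verticalLine, ofReal_one]
    linear_combination ((z / r : ℝ) : ℂ) ^ 2 * I_sq
  rw [verticalLine_cpow_eq_mul hr, ← mul_assoc, hx', verticalLine_eq_mul hr, mul_pow, hI,
    wrightPhase]
  push_cast
  ring

lemma continuous_verticalLine_one_cpow (s : ℝ) :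
    Continuous fun y : ℝ => verticalLine 1 y ^ (s : ℂ) :=
  continuous_iff_continuousAt.2 fun y => (hasDerivAt_verticalLine_one_cpow s y).continuousAt

lemma exists_wrightPhase_bound {p : ℝ} (hp0 : 0 < p) (hp2 : p < 2) (q : ℝ) :
    ∃ C, 0 ≤ C ∧ ∀ r : ℝ, 1 ≤ r →
      ‖(∫ z : ℝ, cexp ((r : ℂ) ^ 2 * wrightPhase p (z / r)) *
        verticalLine 1 (z / r) ^ (q : ℂ)) - ((√(Real.pi / (2 - p)) : ℝ) : ℂ)‖ ≤ C / r ^ 2 := by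
  have hpc : (p : ℂ) ≠ 0 := ofReal_ne_zero.2 hp0.ne'
  have hn : ‖(2 / p : ℂ)‖ = 2 / p := by simp [abs_of_pos hp0]
  have habs : |p - 1| < 1 := by rw [abs_lt]; constructor <;> linarith
  have hle := le_abs_self (p - 1)
  obtain ⟨M, hM⟩ := exists_nat_ge (q / 2)
  have hqM : q ≤ 2 * M := by linarith
  have hW : ∀ y : ℝ, 0 ≤ (1 + y ^ 2) ^ M := fun y => by positivity
  refine exists_laplace_bound (D := wrightPhase p) (g := fun y => verticalLine 1 y ^ (q : ℂ))
    (m := 2 - p) (κ := 1 - |p - 1|) (c := (p - 1) * (p - 2) / 3)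
    (K₃ := 2 / p * (|p * (p - 1) * (p - 2)| / 6))
    (K₄ := 2 / p * (|p * (p - 1) * (p - 2) * (p - 3)| / 24))
    (B := 1 + |q| + |q * (q - 1)|) (q := q) (M := M)
    (by linarith) (by linarith) (by positivity) (by positivity) ?_
    (continuous_verticalLine_one_cpow q) ?_ ?_ ?_ ?_ ?_ ?_
  · have := continuous_verticalLine_one_cpow p
    unfold wrightPhase
    fun_prop
  · intro y
    have h := norm_verticalLine_cpow_sub_taylor_two_le (c := p) (by linarith) y
    have e : wrightPhase p y + ((2 - p : ℝ) : ℂ) * y ^ 2 = -(2 / p * (verticalLine 1 y ^ (p : ℂ) - 1 -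
        I * p * y + p * (p - 1) / 2 * y ^ 2)) := by
      rw [wrightPhase]; push_cast; field_simp; ring
    rw [e, norm_neg, norm_mul, hn]
    calc _ ≤ 2 / p * _ := mul_le_mul_of_nonneg_left h (by positivity)
      _ = _ := by ring
  · intro y
    have h := norm_verticalLine_cpow_sub_taylor_three_le (c := p) (by linarith) y
    have e : wrightPhase p y + ((2 - p : ℝ) : ℂ) * y ^ 2 -
        I * (((p - 1) * (p - 2) / 3 : ℝ) : ℂ) * y ^ 3 =
        -(2 / p * (verticalLine 1 y ^ (p : ℂ) - 1 - I * p * y + p * (p - 1) / 2 * y ^ 2 +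
          I * (p * (p - 1) * (p - 2) / 6) * y ^ 3)) := by
      rw [wrightPhase]; push_cast; field_simp; ring
    rw [e, norm_neg, norm_mul, hn]
    calc _ ≤ 2 / p * _ := mul_le_mul_of_nonneg_left h (by positivity)
      _ = _ := by ring
  · intro y
    have h := norm_verticalLine_cpow_sub_taylor_one_le 0 (c := p) (by norm_num; linarith) y
    set E : ℂ := verticalLine 1 y ^ (p : ℂ) - 1 - I * p * y with hE
    have e : wrightPhase p y = ((-y ^ 2 : ℝ) : ℂ) - ((2 / p : ℝ) : ℂ) * E := by
      rw [wrightPhase, hE]; push_cast; field_simp; ring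
    have h1 : -‖E‖ ≤ E.re := (abs_le.1 (abs_re_le_norm E)).1
    have h2 : 2 / p * (-‖E‖) ≤ 2 / p * E.re := mul_le_mul_of_nonneg_left h1 (by positivity)
    have h3 : 2 / p * ‖E‖ ≤ |p - 1| * y ^ 2 := by
      calc _ ≤ 2 / p * _ := mul_le_mul_of_nonneg_left h (by positivity)
        _ = _ := by rw [abs_mul, abs_of_pos hp0]; field_simp
    have h4 : (wrightPhase p y).re = -y ^ 2 - 2 / p * E.re := by
      rw [e, sub_re, ofReal_re, re_ofReal_mul]
    rw [h4]
    linarith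
  · intro y
    refine (norm_verticalLine_cpow_le M hqM le_rfl).trans (le_mul_of_one_le_left (hW y) ?_)
    linarith [abs_nonneg q, abs_nonneg (q * (q - 1))]
  · intro y
    refine (norm_verticalLine_cpow_sub_one_le M (by linarith) y).trans ?_
    have := hW y
    gcongr
    linarith [abs_nonneg (q * (q - 1))]
  · intro y
    refine (norm_verticalLine_cpow_sub_taylor_one_le M (by linarith) y).trans ?_
    rw [div_le_iff₀ two_pos, mul_assoc, mul_assoc, mul_assoc]
    have := mul_nonneg (hW y) (sq_nonneg y)
    nlinarith [mul_nonneg (abs_nonneg q) this, mul_nonneg (abs_nonneg (q * (q - 1))) this]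

/-- The asymptotics of the Wright function in terms of the saddle point `r`. -/
lemma exists_wrightR_bound {ρ : ℝ} (h1 : -1 < ρ) (h0 : ρ < 0) (μ : ℝ) :
    ∃ A C : ℝ, 0 ≤ C ∧ ∀ r x : ℝ, 1 ≤ r → x * r ^ (-2 * ρ) = 1 / (-ρ) * r ^ 2 →
      |wrightR ρ μ (-x) - A * (r ^ (1 - 2 * μ) * Real.exp (-(r ^ 2 * (1 / (-ρ) - 1))))| ≤
        C / r ^ 2 * (r ^ (1 - 2 * μ) * Real.exp (-(r ^ 2 * (1 / (-ρ) - 1)))) := by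
  obtain ⟨C, hC, hb⟩ := exists_wrightPhase_bound (p := -2 * ρ) (by linarith) (by linarith)
    (1 - 2 * μ)
  refine ⟨√(Real.pi / (2 - -2 * ρ)) / Real.pi, C / Real.pi, by positivity, fun r x hr hx => ?_⟩
  have hr0 : 0 < r := by linarith
  have hρ : 1 / (-ρ) = 2 / (-2 * ρ) := by field_simp
  set F : ℝ := r ^ (1 - 2 * μ) * Real.exp (-(r ^ 2 * (1 / (-ρ) - 1))) with hF
  have hF0 : 0 ≤ F := by positivity
  set J : ℂ := ∫ z : ℝ, cexp ((r : ℂ) ^ 2 * wrightPhase (-2 * ρ) (z / r)) *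
    verticalLine 1 (z / r) ^ ((1 - 2 * μ : ℝ) : ℂ) with hJ
  have hint : (Real.pi : ℂ) * (wrightR ρ μ (-x) : ℂ) = F * J := by
    rw [← integral_eq_wrightR h1 h0 μ x hr0, hJ, ← integral_const_mul]
    congr 1 with z
    rw [exponent_eq_wrightPhase hr0 (hρ ▸ hx), Complex.exp_add,
      verticalLine_cpow_eq_mul hr0 z (1 - 2 * μ), ← ofReal_exp, hF, ← hρ]
    have : r ^ 2 * (1 - 1 / (-ρ)) = -(r ^ 2 * (1 / (-ρ) - 1)) := by ring
    rw [this, ofReal_mul]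
    ring
  set s : ℝ := √(Real.pi / (2 - -2 * ρ))
  have hW : ((wrightR ρ μ (-x) - s / Real.pi * F : ℝ) : ℂ) = (F / Real.pi : ℝ) * (J - s) := by
    have hpi : (Real.pi : ℂ) ≠ 0 := ofReal_ne_zero.2 Real.pi_ne_zero
    push_cast
    field_simp
    linear_combination hint
  rw [← Real.norm_eq_abs, ← Complex.norm_real, hW, norm_mul, Complex.norm_real,
    Real.norm_of_nonneg (by positivity)]
  calc _ ≤ F / Real.pi * (C / r ^ 2) := mul_le_mul_of_nonneg_left (hb r hr) (by positivity)
    _ = _ := by ring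

/-- The saddle point attached to `x`, expressed through `Yfun`. -/
lemma exists_saddle {ρ : ℝ} (h1 : -1 < ρ) (h0 : ρ < 0) {x : ℝ} (hx : 1 / (-ρ) ≤ x) :
    ∃ r : ℝ, 1 ≤ r ∧ x * r ^ (-2 * ρ) = 1 / (-ρ) * r ^ 2 ∧
      Yfun ρ x = r ^ 2 * (1 / (-ρ) - 1) := by
  have hσ : 0 < -ρ := by linarith
  have hρ : ρ ≠ 0 := h0.ne
  have hσ1 : 0 < 1 + ρ := by linarith
  have hx0 : 0 < x := lt_of_lt_of_le (by positivity) hx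
  have hb : 1 ≤ -ρ * x := by rwa [div_le_iff₀' hσ] at hx
  have hb0 : 0 < -ρ * x := by linarith
  set b : ℝ := -ρ * x with hbdef
  have hsq : (b ^ (1 / (2 * (1 + ρ)))) ^ 2 = b ^ (1 / (1 + ρ)) := by
    rw [← Real.rpow_natCast, ← Real.rpow_mul hb0.le]
    congr 1; push_cast; field_simp
  refine ⟨b ^ (1 / (2 * (1 + ρ))), Real.one_le_rpow hb (by positivity), ?_, ?_⟩
  · rw [hsq, ← Real.rpow_mul hb0.le]
    have : b ^ (1 / (1 + ρ)) = b * b ^ (1 / (2 * (1 + ρ)) * (-2 * ρ)) := by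
      rw [← Real.rpow_one_add' hb0.le]
      · congr 1; field_simp; ring
      · have : 1 + 1 / (2 * (1 + ρ)) * (-2 * ρ) = 1 / (1 + ρ) := by field_simp; ring
        rw [this]; positivity
    have hx' : x = 1 / (-ρ) * b := by rw [hbdef]; field_simp
    rw [this, hx']
    ring
  · rw [hsq, Yfun]
    have h2 : (-ρ) ^ (-ρ) * x = (-ρ) ^ (-(1 + ρ)) * b := by
      rw [hbdef, ← mul_assoc, ← Real.rpow_add_one hσ.ne']
      congr 2; ring
    rw [h2, Real.mul_rpow (by positivity) hb0.le, ← Real.rpow_mul hσ.le]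
    have h3 : -(1 + ρ) * (1 / (1 + ρ)) = -1 := by field_simp
    rw [h3, Real.rpow_neg_one]
    field_simp
    ring

end WrightAsymptotics

/-- Exponential decay of the Wright function on the negative real axis. -/
theorem stmt_2 (ρ μ : ℝ) (hρ : ρ ∈ Set.Ioo (-1:ℝ) 0) :
    ∃ A₀ C X : ℝ, 0 < C ∧ 0 < X ∧ ∀ x : ℝ, X ≤ x →
      |wrightR ρ μ (-x) - A₀ * Yfun ρ x ^ (1/2 - μ) * Real.exp (-Yfun ρ x)| ≤
        C * Yfun ρ x ^ (-1/2 - μ) * Real.exp (-Yfun ρ x) := by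
  obtain ⟨h1, h0⟩ := hρ
  have hσ : 0 < -ρ := by linarith
  obtain ⟨A, C, hC, h⟩ := exists_wrightR_bound h1 h0 μ
  set k : ℝ := 1 / (-ρ) - 1 with hk
  have hk0 : 0 < k := by
    rw [hk, sub_pos, lt_div_iff₀ hσ]; linarith
  refine ⟨A * k ^ (-(1 / 2 - μ)), C * k * k ^ (-(1 / 2 - μ)) + 1, 1 / (-ρ), by positivity,
    by positivity, fun x hx => ?_⟩
  obtain ⟨r, hr, hrx, hY⟩ := exists_saddle h1 h0 hx
  have hr0 : 0 < r := by linarith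
  have hb := h r x hr hrx
  rw [← hk] at hY
  rw [← hY] at hb
  set Y : ℝ := Yfun ρ x
  have hY0 : 0 < Y := by rw [hY]; positivity
  have hrY : r ^ (1 - 2 * μ) = k ^ (-(1 / 2 - μ)) * Y ^ (1 / 2 - μ) := by
    rw [hY, Real.mul_rpow (by positivity) hk0.le, ← Real.rpow_natCast, ← Real.rpow_mul hr0.le,
      Real.rpow_neg hk0.le]
    have : ((2 : ℕ) : ℝ) * (1 / 2 - μ) = 1 - 2 * μ := by push_cast; ring
    rw [this]
    field_simp
  have hYd : Y ^ (1 / 2 - μ) / r ^ 2 = k * Y ^ (-1 / 2 - μ) := by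
    have : (1 / 2 - μ : ℝ) = -1 / 2 - μ + 1 := by ring
    rw [this, Real.rpow_add_one hY0.ne', div_eq_iff (by positivity)]
    nth_rewrite 2 [hY]
    ring
  rw [hrY] at hb
  calc _ = _ := by congr 2; ring
    _ ≤ _ := hb
    _ = C * k ^ (-(1 / 2 - μ)) * (Y ^ (1 / 2 - μ) / r ^ 2) * Real.exp (-Y) := by ring
    _ = C * k * k ^ (-(1 / 2 - μ)) * Y ^ (-1 / 2 - μ) * Real.exp (-Y) := by rw [hYd]; ring
    _ ≤ _ := by gcongr; linarith
end

section
/- Let α ∈ (0,1) ∪ (1,2). Then lim_{t→+∞} t² · E_{α,α}(−t) = −1/Γ(−α); that is, E_{α,α}(−t) decays only quadratically on the negative real axis (the leading 1/t term of the asymptotic expansion vanishes because 1/Γ(0) = 0). -/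
open scoped Real

open MeasureTheory Filter Topology Set

theorem Complex.norm_betaIntegral_le (u v : ℂ) :
    ‖Complex.betaIntegral u v‖ ≤ ‖Complex.betaIntegral (u.re : ℂ) (v.re : ℂ)‖ := by
  have hnorm : ∀ a b : ℂ, ∀ x ∈ Ioo (0:ℝ) 1,
      ‖(x : ℂ) ^ (a - 1) * (1 - (x : ℂ)) ^ (b - 1)‖ = x ^ (a.re - 1) * (1 - x) ^ (b.re - 1) := by
    intro a b x hx
    have h1 : (1 - (x : ℂ)) = ((1 - x : ℝ) : ℂ) := by push_cast; ring
    rw [norm_mul, h1, Complex.norm_cpow_eq_rpow_re_of_pos hx.1,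
      Complex.norm_cpow_eq_rpow_re_of_pos (by linarith [hx.2])]
    simp
  have hreal : Complex.betaIntegral (u.re : ℂ) (v.re : ℂ)
      = ((∫ x in (0:ℝ)..1, x ^ (u.re - 1) * (1 - x) ^ (v.re - 1) : ℝ) : ℂ) := by
    rw [Complex.betaIntegral, ← intervalIntegral.integral_ofReal]
    refine intervalIntegral.integral_congr fun x hx => ?_
    rw [uIcc_of_le zero_le_one] at hx
    push_cast
    rw [Complex.ofReal_cpow hx.1, Complex.ofReal_cpow (by linarith [hx.2])]
    push_cast
    rfl
  rw [hreal, Complex.norm_real, Complex.betaIntegral]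
  refine (intervalIntegral.norm_integral_le_integral_norm zero_le_one).trans
    (le_of_eq_of_le ?_ (le_abs_self _))
  rw [intervalIntegral.integral_of_le zero_le_one, intervalIntegral.integral_of_le zero_le_one,
    integral_Ioc_eq_integral_Ioo, integral_Ioc_eq_integral_Ioo]
  exact setIntegral_congr_fun measurableSet_Ioo fun x hx => hnorm u v x hx

theorem Complex.norm_Gamma_div_Gamma_add_le {z : ℂ} (hz : 0 < z.re) {c : ℝ} (hc : 0 < c) :
    ‖Complex.Gamma z‖ / ‖Complex.Gamma (z + c)‖ ≤ Real.Gamma z.re / Real.Gamma (z.re + c) := by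
  have hG : ∀ w : ℂ, 0 < w.re →
      ‖Complex.betaIntegral w c‖
        = ‖Complex.Gamma w‖ / ‖Complex.Gamma (w + c)‖ * Real.Gamma c := by
    intro w hw
    have h := Complex.Gamma_mul_Gamma_eq_betaIntegral (s := w) (t := c) hw (by simpa using hc)
    have hne : Complex.Gamma (w + c) ≠ 0 :=
      Complex.Gamma_ne_zero_of_re_pos (by simp; linarith)
    have h' := congrArg norm h
    rw [norm_mul, norm_mul, Complex.Gamma_ofReal, Complex.norm_real,
      Real.norm_of_nonneg (Real.Gamma_pos_of_pos hc).le] at h'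
    have := norm_pos_iff.2 hne
    field_simp
    linarith
  have hb := Complex.norm_betaIntegral_le z c
  rw [Complex.ofReal_re, hG z hz, hG z.re (by simpa using hz)] at hb
  have hb' := le_of_mul_le_mul_right hb (Real.Gamma_pos_of_pos hc)
  rwa [← Complex.ofReal_add, Complex.Gamma_ofReal, Complex.Gamma_ofReal, Complex.norm_real,
    Complex.norm_real, Real.norm_of_nonneg (Real.Gamma_pos_of_pos hz).le,
    Real.norm_of_nonneg (Real.Gamma_pos_of_pos (by linarith)).le] at hb'

theorem Complex.sin_pi_mul_half_add (y : ℝ) :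
    Complex.sin (π * (1 / 2 + y * Complex.I)) = (Real.cosh (π * y) : ℂ) := by
  rw [show (π : ℂ) * (1 / 2 + y * Complex.I) = ((π * y : ℝ) : ℂ) * Complex.I + π / 2 by
    push_cast; ring, Complex.sin_add_pi_div_two, Complex.cos_mul_I, Complex.ofReal_cosh]

theorem Complex.sq_norm_Gamma_half_add_mul_I (y : ℝ) :
    ‖Complex.Gamma (1 / 2 + y * Complex.I)‖ ^ 2 = π / Real.cosh (π * y) := by
  have h := Complex.Gamma_mul_Gamma_one_sub (1 / 2 + y * Complex.I)
  have h1 : (1 : ℂ) - (1 / 2 + y * Complex.I)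
      = (starRingEnd ℂ) (1 / 2 + y * Complex.I) := by
    apply Complex.ext
    · simp; norm_num
    · simp
  rw [h1, Complex.Gamma_conj, Complex.mul_conj, Complex.sin_pi_mul_half_add, ← Complex.ofReal_div] at h
  rw [← Complex.normSq_eq_norm_sq]
  exact_mod_cast h

theorem Real.cosh_le_exp_abs (x : ℝ) : Real.cosh x ≤ Real.exp |x| := by
  rw [← Real.cosh_abs, Real.cosh_eq]
  have : Real.exp (-|x|) ≤ Real.exp |x| := Real.exp_le_exp.2 (by linarith [abs_nonneg x])
  linarith

theorem Real.inv_cosh_le (x : ℝ) : (Real.cosh x)⁻¹ ≤ 2 * Real.exp (-|x|) := by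
  rw [Real.exp_neg, ← Real.cosh_abs, Real.cosh_eq]
  have h := Real.exp_pos |x|
  have h' := Real.exp_pos (-|x|)
  rw [inv_le_comm₀ (by positivity) (by positivity), mul_inv, inv_inv]
  linarith

/-- The reciprocal Gamma function in the half-plane `1/2 ≤ re z`. -/
theorem Complex.norm_inv_Gamma_le {z : ℂ} (hz : 1 / 2 ≤ z.re) :
    ‖(Complex.Gamma z)⁻¹‖ ≤ (Real.Gamma z.re)⁻¹ * Real.exp (π / 2 * |z.im|) := by
  have hpi := Real.pi_pos
  set w : ℂ := 1 / 2 + z.im * Complex.I with hw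
  have hwre : w.re = 1 / 2 := by simp [hw]
  have hw0 : 0 < ‖Complex.Gamma w‖ :=
    norm_pos_iff.2 (Complex.Gamma_ne_zero_of_re_pos (by rw [hwre]; norm_num))
  have hz0 : 0 < ‖Complex.Gamma z‖ :=
    norm_pos_iff.2 (Complex.Gamma_ne_zero_of_re_pos (by linarith))
  have hGz : 0 < Real.Gamma z.re := Real.Gamma_pos_of_pos (by linarith)
  have key : ‖Complex.Gamma w‖ / ‖Complex.Gamma z‖ ≤ √π / Real.Gamma z.re := by
    rcases hz.eq_or_lt with h | h
    · have : w = z := by apply Complex.ext <;> simp [hw, ← h]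
      rw [this, div_self hz0.ne', ← h, Real.Gamma_one_half_eq, div_self (by positivity)]
    · have := Complex.norm_Gamma_div_Gamma_add_le (z := w) (by rw [hwre]; norm_num)
        (c := z.re - 1 / 2) (by linarith)
      have e : w + ((z.re - 1 / 2 : ℝ) : ℂ) = z := by
        apply Complex.ext <;> simp [hw]
      rw [e, hwre, Real.Gamma_one_half_eq] at this
      simpa using this
  have hhalf : √π * Real.exp (-(π / 2 * |z.im|)) ≤ ‖Complex.Gamma w‖ := by
    refine le_of_sq_le_sq ?_ hw0.le
    rw [Complex.sq_norm_Gamma_half_add_mul_I, mul_pow, Real.sq_sqrt hpi.le, ← Real.exp_nat_mul,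
      div_eq_mul_inv π (Real.cosh _)]
    refine mul_le_mul_of_nonneg_left ?_ hpi.le
    rw [show ((2 : ℕ) : ℝ) * -(π / 2 * |z.im|) = -|π * z.im| by
      rw [abs_mul, abs_of_pos hpi]; push_cast; ring, Real.exp_neg]
    exact inv_anti₀ (Real.cosh_pos _) (Real.cosh_le_exp_abs _)
  rw [norm_inv]
  have h1 : √π * Real.exp (-(π / 2 * |z.im|)) / ‖Complex.Gamma z‖ ≤ √π / Real.Gamma z.re :=
    (div_le_div_of_nonneg_right hhalf hz0.le).trans key
  rw [Real.exp_neg] at h1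
  have h2 : 0 < √π := by positivity
  have h3 := Real.exp_pos (π / 2 * |z.im|)
  field_simp at h1 ⊢
  linarith

theorem integrable_exp_neg_mul_abs {c : ℝ} (hc : 0 < c) :
    Integrable fun y : ℝ => Real.exp (-(c * |y|)) := by
  rw [← integrableOn_univ, ← Iic_union_Ioi (a := (0:ℝ)), integrableOn_union]
  constructor
  · refine (integrableOn_exp_mul_Iic hc 0).congr_fun (fun y hy => ?_) measurableSet_Iic
    simp only [abs_of_nonpos (mem_Iic.1 hy)]
    ring_nf
  · refine (integrableOn_exp_mul_Ioi (neg_neg_of_pos hc) 0).congr_fun (fun y hy => ?_)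
      measurableSet_Ioi
    simp only [abs_of_pos (mem_Ioi.1 hy)]
    ring_nf

theorem continuous_inv_cosh_pi_mul : Continuous fun y : ℝ => (Real.cosh (π * y))⁻¹ :=
  (Real.continuous_cosh.comp (continuous_const.mul continuous_id)).inv₀
    fun _ => (Real.cosh_pos _).ne'

theorem integrable_inv_cosh_pi_mul : Integrable fun y : ℝ => (Real.cosh (π * y))⁻¹ := by
  refine ((integrable_exp_neg_mul_abs Real.pi_pos).const_mul 2).mono'
    continuous_inv_cosh_pi_mul.aestronglyMeasurable (ae_of_all _ fun y => ?_)
  rw [Real.norm_of_nonneg (inv_nonneg.2 (Real.cosh_pos _).le)]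
  simpa [abs_mul, abs_of_pos Real.pi_pos] using Real.inv_cosh_le (π * y)

theorem Real.tendsto_sinh_atTop : Tendsto Real.sinh atTop atTop :=
  tendsto_atTop_mono' _ ((eventually_ge_atTop 0).mono fun _ hx => Real.self_le_sinh_iff.2 hx)
    tendsto_id

theorem Real.tendsto_sinh_atBot : Tendsto Real.sinh atBot atBot :=
  tendsto_atBot_mono' _ ((eventually_le_atBot 0).mono fun _ hx => Real.sinh_le_self_iff.2 hx)
    tendsto_id

theorem integral_inv_cosh_pi_mul : ∫ y : ℝ, (Real.cosh (π * y))⁻¹ = 1 := by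
  have hpi := Real.pi_pos
  have hd : ∀ y : ℝ, HasDerivAt (fun y => Real.arctan (Real.sinh (π * y)) / π)
      (Real.cosh (π * y))⁻¹ y := by
    intro y
    have h1 : HasDerivAt (fun y : ℝ => π * y) π y := by
      simpa using (hasDerivAt_id y).const_mul π
    refine (h1.sinh.arctan.div_const π).congr_deriv ?_
    have := Real.cosh_pos (π * y)
    rw [← Real.cosh_sq' (π * y)]
    field_simp
  have htop : Tendsto (fun y => Real.arctan (Real.sinh (π * y)) / π) atTop (𝓝 (π / 2 / π)) :=
    ((tendsto_nhds_of_tendsto_nhdsWithin Real.tendsto_arctan_atTop).comp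
      (Real.tendsto_sinh_atTop.comp (tendsto_id.const_mul_atTop hpi))).div_const π
  have hbot : Tendsto (fun y => Real.arctan (Real.sinh (π * y)) / π) atBot (𝓝 (-(π / 2) / π)) :=
    ((tendsto_nhds_of_tendsto_nhdsWithin Real.tendsto_arctan_atBot).comp
      (Real.tendsto_sinh_atBot.comp (tendsto_id.const_mul_atBot hpi))).div_const π
  rw [integral_of_hasDerivAt_of_tendsto hd integrable_inv_cosh_pi_mul hbot htop]
  field_simp
  norm_num

theorem Complex.exists_norm_inv_Gamma_le_of_re_mem_Icc (m : ℕ) :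
    ∀ {κ a : ℝ} (_ : π / 2 < κ) (_ : 1 / 2 - m ≤ a) (b : ℝ), ∃ C : ℝ, ∀ z : ℂ, z.re ∈ Icc a b →
      ‖(Complex.Gamma z)⁻¹‖ ≤ C * Real.exp (κ * |z.im|) := by
  induction m with
  | zero =>
    intro κ a hκ ha b
    rw [Nat.cast_zero, sub_zero] at ha
    have hcont : ContinuousOn (fun x : ℝ => (Real.Gamma x)⁻¹) (Icc a b) := by
      intro x hx
      have hx0 : 0 < x := by linarith [hx.1]
      exact ((Real.differentiableOn_Gamma_Ioi.continuousOn.continuousAt (Ioi_mem_nhds hx0)).inv₀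
        (Real.Gamma_pos_of_pos hx0).ne').continuousWithinAt
    obtain ⟨C, hC⟩ := isCompact_Icc.exists_bound_of_continuousOn hcont
    refine ⟨C, fun z hz => (Complex.norm_inv_Gamma_le (ha.trans hz.1)).trans ?_⟩
    have h := hC _ hz
    exact mul_le_mul ((le_abs_self _).trans h)
      (Real.exp_le_exp.2 (mul_le_mul_of_nonneg_right hκ.le (abs_nonneg _)))
      (Real.exp_pos _).le ((norm_nonneg _).trans h)
  | succ m ih =>
    intro κ a hκ ha b
    obtain ⟨κ', hκ', hκκ'⟩ := exists_between hκ
    push_cast at ha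
    obtain ⟨C, hC⟩ := ih (a := a + 1) hκ' (by linarith) (b + 1)
    set δ := κ - κ' with hδ
    have hδ0 : 0 < δ := sub_pos.2 hκκ'
    refine ⟨(|a| + |b| + δ⁻¹) * C, fun z hz => ?_⟩
    have h1 := hC (z + 1) (by simpa using hz)
    simp only [Complex.add_im, Complex.one_im, add_zero] at h1
    rw [Complex.one_div_Gamma_eq_self_mul_one_div_Gamma_add_one, norm_mul]
    have hz1 : ‖z‖ ≤ (|a| + |b| + δ⁻¹) * Real.exp (δ * |z.im|) := by
      have hre : |z.re| ≤ |a| + |b| :=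
        (abs_le_max_abs_abs hz.1 hz.2).trans
          (max_le (by linarith [abs_nonneg b]) (by linarith [abs_nonneg a]))
      have him : |z.im| ≤ δ⁻¹ * Real.exp (δ * |z.im|) := by
        rw [inv_mul_eq_div, le_div_iff₀ hδ0]
        linarith [Real.add_one_le_exp (δ * |z.im|)]
      have he : 1 ≤ Real.exp (δ * |z.im|) := Real.one_le_exp (by positivity)
      have := Complex.norm_le_abs_re_add_abs_im z
      have : |a| + |b| ≤ (|a| + |b|) * Real.exp (δ * |z.im|) :=
        le_mul_of_one_le_right (by positivity) he
      linarith
    refine (mul_le_mul hz1 h1 (norm_nonneg _) (by positivity)).trans_eq ?_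
    rw [show κ * |z.im| = δ * |z.im| + κ' * |z.im| by rw [hδ]; ring, Real.exp_add]
    ring

/-- Exponential bound for the reciprocal Gamma function on a vertical strip. -/
theorem Complex.exists_norm_inv_Gamma_le {κ : ℝ} (hκ : π / 2 < κ) (a b : ℝ) :
    ∃ C : ℝ, ∀ z : ℂ, z.re ∈ Icc a b →
      ‖(Complex.Gamma z)⁻¹‖ ≤ C * Real.exp (κ * |z.im|) := by
  obtain ⟨m, hm⟩ := exists_nat_ge (1 / 2 - a)
  exact Complex.exists_norm_inv_Gamma_le_of_re_mem_Icc m hκ (by linarith) b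

theorem Real.exp_neg_mul_rpow_le_Gamma {R x : ℝ} (hR : 0 < R) (hx : 1 ≤ x) :
    Real.exp (-R) * R ^ (x - 1) ≤ Real.Gamma x := by
  have hx0 : 0 < x := by linarith
  have hint := Real.GammaIntegral_convergent hx0
  rw [Real.Gamma_eq_integral hx0, ← integral_exp_neg_Ioi R, ← integral_mul_const]
  refine le_trans (setIntegral_mono_on ((integrableOn_exp_neg_Ioi R).mul_const _)
    (hint.mono_set (Ioi_subset_Ioi hR.le)) measurableSet_Ioi fun u hu => ?_)
    (setIntegral_mono_set hint ?_ (Ioi_subset_Ioi hR.le).eventuallyLE)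
  · exact mul_le_mul_of_nonneg_left
      (Real.rpow_le_rpow hR.le (mem_Ioi.1 hu).le (by linarith)) (Real.exp_pos _).le
  · refine (ae_restrict_mem measurableSet_Ioi).mono fun u hu => ?_
    exact mul_nonneg (Real.exp_pos _).le (Real.rpow_nonneg (mem_Ioi.1 hu).le _)

theorem summable_pow_div_Gamma {a : ℝ} (ha : 0 < a) (b x : ℝ) :
    Summable fun k : ℕ => x ^ k / Real.Gamma (k * a + b) := by
  set r : ℝ := 2 * |x| + 1 with hr
  have hr0 : 0 < r := by positivity
  set R : ℝ := r ^ a⁻¹ with hR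
  have hR0 : 0 < R := Real.rpow_pos_of_pos hr0 _
  have hRa : R ^ a = r := by
    rw [hR, ← Real.rpow_mul hr0.le, inv_mul_cancel₀ ha.ne', Real.rpow_one]
  have hlt : |x| / r < 1 := by
    rw [div_lt_one hr0, hr]
    linarith [abs_nonneg x]
  refine Summable.of_norm_bounded_eventually_nat
    (g := fun k => Real.exp R * R ^ (1 - b) * (|x| / r) ^ k)
    ((summable_geometric_of_lt_one (by positivity) hlt).mul_left _) ?_
  obtain ⟨N, hN⟩ := exists_nat_ge ((1 - b) / a)
  filter_upwards [eventually_ge_atTop N] with k hk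
  have hk1 : 1 ≤ k * a + b := by
    have : (1 - b) / a ≤ k := hN.trans (by exact_mod_cast hk)
    rw [div_le_iff₀ ha] at this
    linarith
  have hG := Real.exp_neg_mul_rpow_le_Gamma hR0 hk1
  have hGpos : 0 < Real.Gamma (k * a + b) := Real.Gamma_pos_of_pos (by linarith)
  have hexp : R ^ (k * a + b - 1) = r ^ k * (R ^ (1 - b))⁻¹ := by
    rw [show (k : ℝ) * a + b - 1 = a * k + -(1 - b) by ring, Real.rpow_add hR0,
      Real.rpow_mul hR0.le, hRa, Real.rpow_natCast, Real.rpow_neg hR0.le]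
  rw [hexp, Real.exp_neg] at hG
  rw [norm_div, norm_pow, Real.norm_eq_abs, Real.norm_of_nonneg hGpos.le, div_le_iff₀ hGpos]
  calc |x| ^ k = Real.exp R * R ^ (1 - b) * (|x| / r) ^ k *
      ((Real.exp R)⁻¹ * (r ^ k * (R ^ (1 - b))⁻¹)) := by
        have := Real.rpow_pos_of_pos hR0 (1 - b)
        rw [div_pow]
        field_simp
    _ ≤ _ := mul_le_mul_of_nonneg_left hG (by positivity)

theorem Complex.sinh_sq_le_sq_norm_sin (x y : ℝ) :
    Real.sinh y ^ 2 ≤ ‖Complex.sin (x + y * Complex.I)‖ ^ 2 := by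
  have h : Complex.sin (x + y * Complex.I)
      = ((Real.sin x * Real.cosh y : ℝ) : ℂ) + ((Real.cos x * Real.sinh y : ℝ) : ℂ) * Complex.I := by
    rw [Complex.sin_add, Complex.sin_mul_I, Complex.cos_mul_I]
    push_cast
    ring
  rw [h, ← Complex.normSq_eq_norm_sq, Complex.normSq_add_mul_I, mul_pow, mul_pow, Real.cosh_sq]
  nlinarith [Real.sin_sq_add_cos_sq x, sq_nonneg (Real.sin x)]

theorem Complex.sinh_abs_le_norm_sin_pi_mul (x y : ℝ) :
    Real.sinh (π * |y|) ≤ ‖Complex.sin (π * (x + y * Complex.I))‖ := by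
  refine le_of_sq_le_sq ?_ (norm_nonneg _)
  have h := Complex.sinh_sq_le_sq_norm_sin (π * x) (π * y)
  have e : Real.sinh (π * |y|) ^ 2 = Real.sinh (π * y) ^ 2 := by
    rcases abs_cases y with h | h <;> rw [h.1]
    rw [mul_neg, Real.sinh_neg, neg_sq]
  rw [e]
  refine h.trans_eq ?_
  push_cast
  ring_nf

theorem Complex.sin_pi_mul_ne_zero {z : ℂ} (hz0 : z ≠ 0) (hz : |z.re| ≤ 1 / 2) :
    Complex.sin (π * z) ≠ 0 := by
  intro h
  obtain ⟨k, hk⟩ := Complex.sin_eq_zero_iff.1 h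
  have hzk : z = k := by
    have hpi : (π : ℂ) ≠ 0 := by exact_mod_cast Real.pi_ne_zero
    rw [mul_comm (k : ℂ)] at hk
    exact mul_left_cancel₀ hpi hk
  rw [hzk] at hz hz0
  have hk1 : |k| < 1 := by
    have : |(k : ℝ)| ≤ 1 / 2 := by simpa using hz
    have : |(k : ℝ)| < 1 := by linarith
    exact_mod_cast this
  rw [Int.abs_lt_one_iff] at hk1
  simp [hk1] at hz0

theorem Complex.sin_pi_mul_neg_half_add (y : ℝ) :
    Complex.sin (π * (-1 / 2 + y * Complex.I)) = -(Real.cosh (π * y) : ℂ) := by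
  rw [show (π : ℂ) * (-1 / 2 + y * Complex.I) = ((π * y : ℝ) : ℂ) * Complex.I - π / 2 by
    push_cast; ring, Complex.sin_sub_pi_div_two, Complex.cos_mul_I, Complex.ofReal_cosh]

/-- The extension of `(g z - g 0) / sin (π z)` across its removable singularity at `0`. -/
noncomputable def sinQuotient (g : ℂ → ℂ) (z : ℂ) : ℂ :=
  dslope g 0 z / dslope (fun w => Complex.sin (π * w)) 0 z

theorem sinQuotient_of_ne {g : ℂ → ℂ} {z : ℂ} (hz : z ≠ 0) :
    sinQuotient g z = (g z - g 0) / Complex.sin (π * z) := by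
  rw [sinQuotient, dslope_of_ne _ hz, dslope_of_ne _ hz, slope_def_field, slope_def_field,
    div_div_div_cancel_right₀ (sub_ne_zero.2 hz)]
  simp

theorem differentiableOn_sinQuotient {g : ℂ → ℂ} (hg : Differentiable ℂ g) :
    DifferentiableOn ℂ (sinQuotient g) {z | |z.re| ≤ 1 / 2} := by
  have hsin : Differentiable ℂ fun w : ℂ => Complex.sin (π * w) := by fun_prop
  refine DifferentiableOn.div
    (((Complex.differentiableOn_dslope univ_mem).2 hg.differentiableOn).mono (subset_univ _))
    (((Complex.differentiableOn_dslope univ_mem).2 hsin.differentiableOn).mono (subset_univ _))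
    fun z hz => ?_
  rcases eq_or_ne z 0 with rfl | hz0
  · have hd : HasDerivAt (fun w : ℂ => Complex.sin (π * w)) π 0 := by
      simpa using ((hasDerivAt_id (0 : ℂ)).const_mul (π : ℂ)).csin
    rw [dslope_same, hd.deriv]
    exact_mod_cast Real.pi_ne_zero
  · rw [dslope_of_ne _ hz0, slope_def_field]
    simpa using ⟨Complex.sin_pi_mul_ne_zero hz0 hz, hz0⟩

section StripShift

variable {g : ℂ → ℂ} {C κ : ℝ}

theorem norm_sinQuotient_le
    (hC : ∀ z : ℂ, |z.re| ≤ 1 / 2 → ‖g z‖ ≤ C * Real.exp (κ * |z.im|))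
    {x y : ℝ} (hx : |x| ≤ 1 / 2) (hy : y ≠ 0) :
    ‖sinQuotient g (x + y * Complex.I)‖
      ≤ (C * Real.exp (κ * |y|) + ‖g 0‖) / Real.sinh (π * |y|) := by
  have hne : (x + y * Complex.I : ℂ) ≠ 0 := by
    intro h
    exact hy (by simpa using congrArg Complex.im h)
  have hs : 0 < Real.sinh (π * |y|) :=
    Real.sinh_pos_iff.2 (mul_pos Real.pi_pos (abs_pos.2 hy))
  rw [sinQuotient_of_ne hne, norm_div]
  refine div_le_div₀ ?_ ?_ hs (Complex.sinh_abs_le_norm_sin_pi_mul x y)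
  · exact add_nonneg ((norm_nonneg _).trans (by simpa using hC (x + y * Complex.I) (by simpa using hx)))
      (norm_nonneg _)
  · exact (norm_sub_le _ _).trans
      (add_le_add (by simpa using hC (x + y * Complex.I) (by simpa using hx)) le_rfl)

theorem tendsto_exp_div_sinh_atTop (hκ : κ < π) (B : ℝ) :
    Tendsto (fun T : ℝ => (C * Real.exp (κ * |T|) + B) / Real.sinh (π * |T|)) atTop (𝓝 0) := by
  have hpi := Real.pi_pos
  have h1 : Tendsto (fun T : ℝ => Real.exp ((κ - π) * T)) atTop (𝓝 0) :=
    Real.tendsto_exp_atBot.comp (tendsto_id.const_mul_atTop_of_neg (by linarith))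
  have h2 : ∀ c : ℝ, c < 0 → Tendsto (fun T : ℝ => Real.exp (c * T)) atTop (𝓝 0) := fun c hc =>
    Real.tendsto_exp_atBot.comp (tendsto_id.const_mul_atTop_of_neg hc)
  have h3 : Tendsto (fun T : ℝ => (C * Real.exp ((κ - π) * T) + B * Real.exp (-π * T)) /
      ((1 - Real.exp (-(2 * π) * T)) / 2)) atTop (𝓝 ((C * 0 + B * 0) / ((1 - 0) / 2))) :=
    ((h1.const_mul C).add ((h2 _ (by linarith)).const_mul B)).div
      ((tendsto_const_nhds.sub (h2 _ (by linarith))).div_const 2) (by norm_num)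
  simp only [mul_zero, add_zero, zero_div] at h3
  refine h3.congr' ?_
  filter_upwards [eventually_gt_atTop 0] with T hT
  rw [abs_of_pos hT, Real.sinh_eq]
  have e1 : Real.exp ((κ - π) * T) = Real.exp (κ * T) * Real.exp (-(π * T)) := by
    rw [← Real.exp_add]; ring_nf
  have e2 : Real.exp (-(2 * π) * T) = Real.exp (-(π * T)) * Real.exp (-(π * T)) := by
    rw [← Real.exp_add]; ring_nf
  have e3 : Real.exp (π * T) * Real.exp (-(π * T)) = 1 := by
    rw [← Real.exp_add]; simp
  have e4 := Real.exp_pos (-(π * T))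
  rw [e1, e2, neg_mul, 
    ← mul_div_mul_right (C * Real.exp (κ * T) + B) _ e4.ne']
  congr 1
  · ring
  · linear_combination (-1 / 2 : ℝ) * e3

theorem norm_integral_sinQuotient_le
    (hC : ∀ z : ℂ, |z.re| ≤ 1 / 2 → ‖g z‖ ≤ C * Real.exp (κ * |z.im|)) {y : ℝ} (hy : y ≠ 0) :
    ‖∫ x : ℝ in (-1 / 2)..(1 / 2), sinQuotient g (x + y * Complex.I)‖
      ≤ (C * Real.exp (κ * |y|) + ‖g 0‖) / Real.sinh (π * |y|) := by
  have h := intervalIntegral.norm_integral_le_of_norm_le_const (a := (-1 / 2 : ℝ)) (b := 1 / 2)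
    (f := fun x : ℝ => sinQuotient g (x + y * Complex.I))
    (C := (C * Real.exp (κ * |y|) + ‖g 0‖) / Real.sinh (π * |y|)) fun x hx => by
      rw [uIoc_of_le (by norm_num)] at hx
      exact norm_sinQuotient_le hC (abs_le.2 ⟨by linarith [hx.1], hx.2⟩) hy
  refine h.trans_eq ?_
  norm_num

theorem integrable_mul_inv_cosh {f : ℝ → ℂ} (hf : Continuous f) (hκ : κ < π)
    (hC : ∀ y, ‖f y‖ ≤ C * Real.exp (κ * |y|)) :
    Integrable fun y : ℝ => f y * ((Real.cosh (π * y))⁻¹ : ℝ) := by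
  have hC0 : 0 ≤ C := by simpa using (norm_nonneg _).trans (hC 0)
  refine ((integrable_exp_neg_mul_abs (sub_pos.2 hκ)).const_mul (C * 2)).mono'
    (hf.mul (Complex.continuous_ofReal.comp continuous_inv_cosh_pi_mul)).aestronglyMeasurable
    (ae_of_all _ fun y => ?_)
  rw [norm_mul, Complex.norm_real, Real.norm_of_nonneg (inv_nonneg.2 (Real.cosh_pos _).le)]
  refine (mul_le_mul (hC y) (Real.inv_cosh_le _) (inv_nonneg.2 (Real.cosh_pos _).le)
    (by positivity)).trans_eq ?_
  rw [abs_mul, abs_of_pos Real.pi_pos,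
    show -((π - κ) * |y|) = κ * |y| + -(π * |y|) by ring, Real.exp_add]
  ring

/-- Residue theorem for `π g(z) / sin (π z)` on the strip `|re z| ≤ 1/2`. -/
theorem integral_add_integral_eq_two_mul (hg : Differentiable ℂ g) (hκ : κ < π)
    (hC : ∀ z : ℂ, |z.re| ≤ 1 / 2 → ‖g z‖ ≤ C * Real.exp (κ * |z.im|)) :
    (∫ y : ℝ, g (-1 / 2 + y * Complex.I) * ((Real.cosh (π * y))⁻¹ : ℝ)) +
      ∫ y : ℝ, g (1 / 2 + y * Complex.I) * ((Real.cosh (π * y))⁻¹ : ℝ) = 2 * g 0 := by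
  have hgc := hg.continuous
  have hL : Integrable fun y : ℝ => g (-1 / 2 + y * Complex.I) * ((Real.cosh (π * y))⁻¹ : ℝ) :=
    integrable_mul_inv_cosh (by fun_prop) hκ fun y => by
      simpa using hC (-1 / 2 + y * Complex.I) (by norm_num [abs_le])
  have hR : Integrable fun y : ℝ => g (1 / 2 + y * Complex.I) * ((Real.cosh (π * y))⁻¹ : ℝ) :=
    integrable_mul_inv_cosh (by fun_prop) hκ fun y => by
      simpa using hC (1 / 2 + y * Complex.I) (by norm_num [abs_le])
  have h0 : Integrable fun y : ℝ => 2 * g 0 * ((Real.cosh (π * y))⁻¹ : ℝ) :=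
    integrable_inv_cosh_pi_mul.ofReal.const_mul _
  have hI0 : ∫ y : ℝ, 2 * g 0 * (((Real.cosh (π * y))⁻¹ : ℝ) : ℂ) = 2 * g 0 := by
    rw [integral_const_mul, integral_complex_ofReal, integral_inv_cosh_pi_mul]
    simp
  have hright : ∀ y : ℝ, sinQuotient g (1 / 2 + y * Complex.I)
      = (g (1 / 2 + y * Complex.I) - g 0) * ((Real.cosh (π * y))⁻¹ : ℝ) := by
    intro y
    rw [sinQuotient_of_ne (fun h => by simpa using congrArg Complex.re h),
      Complex.sin_pi_mul_half_add, div_eq_mul_inv, Complex.ofReal_inv]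
  have hleft : ∀ y : ℝ, sinQuotient g (-1 / 2 + y * Complex.I)
      = -((g (-1 / 2 + y * Complex.I) - g 0) * ((Real.cosh (π * y))⁻¹ : ℝ)) := by
    intro y
    rw [sinQuotient_of_ne (fun h => by simpa using congrArg Complex.re h),
      Complex.sin_pi_mul_neg_half_add, div_neg, div_eq_mul_inv, Complex.ofReal_inv]
  set S : ℝ → ℂ := fun y => g (-1 / 2 + y * Complex.I) * ((Real.cosh (π * y))⁻¹ : ℝ) +
    g (1 / 2 + y * Complex.I) * ((Real.cosh (π * y))⁻¹ : ℝ) -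
    2 * g 0 * ((Real.cosh (π * y))⁻¹ : ℝ) with hS
  have hSi : Integrable S := (hL.add hR).sub h0
  have hrect : ∀ T : ℝ, Complex.I * ∫ y in (-T)..T, S y =
      (∫ x : ℝ in (-1 / 2)..(1 / 2), sinQuotient g (x + T * Complex.I)) -
      ∫ x : ℝ in (-1 / 2)..(1 / 2), sinQuotient g (x + (-T : ℝ) * Complex.I) := by
    intro T
    have hsub : (uIcc (-1 / 2 : ℝ) (1 / 2) ×ℂ uIcc (-T) T) ⊆ {z : ℂ | |z.re| ≤ 1 / 2} := by
      intro z hz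
      have := hz.1
      rw [mem_preimage, uIcc_of_le (by norm_num)] at this
      exact abs_le.2 ⟨by linarith [this.1], this.2⟩
    have h := Complex.integral_boundary_rect_eq_zero_of_differentiableOn (sinQuotient g)
      ⟨-1 / 2, -T⟩ ⟨1 / 2, T⟩ ((differentiableOn_sinQuotient hg).mono hsub)
    simp only [smul_eq_mul] at h
    have hcr : IntervalIntegrable (fun y : ℝ => sinQuotient g (1 / 2 + y * Complex.I))
        volume (-T) T := by
      simp only [hright]
      exact (((hgc.comp (by fun_prop)).sub continuous_const).mul
        (Complex.continuous_ofReal.comp continuous_inv_cosh_pi_mul)).intervalIntegrable _ _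
    have hcl : IntervalIntegrable (fun y : ℝ => sinQuotient g (-1 / 2 + y * Complex.I))
        volume (-T) T := by
      simp only [hleft]
      exact (((hgc.comp (by fun_prop)).sub continuous_const).mul
        (Complex.continuous_ofReal.comp continuous_inv_cosh_pi_mul)).neg.intervalIntegrable _ _
    have hSeq : ∫ y in (-T)..T, S y =
        (∫ y : ℝ in (-T)..T, sinQuotient g (1 / 2 + y * Complex.I)) -
        ∫ y : ℝ in (-T)..T, sinQuotient g (-1 / 2 + y * Complex.I) := by
      rw [← intervalIntegral.integral_sub hcr hcl]
      refine intervalIntegral.integral_congr fun y _ => ?_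
      simp only [hright, hleft, hS]
      ring
    rw [hSeq]
    push_cast at h ⊢
    linear_combination h
  have hzero : Tendsto (fun T : ℝ => ∫ y in (-T)..T, S y) atTop (𝓝 0) := by
    have hb := (tendsto_exp_div_sinh_atTop (C := C) hκ ‖g 0‖).const_mul 2
    rw [mul_zero] at hb
    refine squeeze_zero_norm' ?_ hb
    filter_upwards [eventually_gt_atTop 0] with T hT
    have h1 := norm_integral_sinQuotient_le hC hT.ne'
    have h2 := norm_integral_sinQuotient_le hC (neg_ne_zero.2 hT.ne')
    rw [abs_neg] at h2
    have h3 := congrArg norm (hrect T)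
    rw [norm_mul, Complex.norm_I, one_mul] at h3
    rw [h3]
    exact (norm_sub_le _ _).trans (by linarith)
  have hlim := intervalIntegral_tendsto_integral hSi tendsto_neg_atTop_atBot tendsto_id
  have hSint := tendsto_nhds_unique hlim hzero
  have hSsum := (integral_sub (hL.add hR) h0).symm.trans hSint
  rw [hI0] at hSsum
  rw [← integral_add hL hR]
  exact sub_eq_zero.1 hSsum

end StripShift

section MittagLeffler

/-- Interpolation `t ^ s / Γ(α s + α)` of the absolute values of the terms of `E_{α,α}(-t)`. -/
noncomputable def mlKernel (α t : ℝ) (s : ℂ) : ℂ :=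
  (t : ℂ) ^ s * (Complex.Gamma (α * s + α))⁻¹

/-- Mellin-Barnes integral over the line `re s = n - 1/2`, up to sign. -/
noncomputable def mlLine (α t : ℝ) (n : ℤ) : ℂ :=
  ∫ y : ℝ, mlKernel α t (n - 1 / 2 + y * Complex.I) * ((Real.cosh (π * y))⁻¹ : ℝ)

variable {α t : ℝ}

theorem differentiable_mlKernel (ht : 0 < t) : Differentiable ℂ (mlKernel α t) := by
  have ht' : (t : ℂ) ≠ 0 := by exact_mod_cast ht.ne'
  refine Differentiable.mul (fun s => ?_)
    (Complex.differentiable_one_div_Gamma.comp (by fun_prop : Differentiable ℂ fun s : ℂ => α * s + α))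
  exact (hasDerivAt_id s).differentiableAt.const_cpow (Or.inl ht')

theorem norm_mlKernel (ht : 0 < t) (s : ℂ) :
    ‖mlKernel α t s‖ = t ^ s.re * ‖(Complex.Gamma (α * s + α))⁻¹‖ := by
  rw [mlKernel, norm_mul, Complex.norm_cpow_eq_rpow_re_of_pos ht]

theorem mlLine_add_mlLine_add_one (hα : 0 < α) (hα2 : α < 2) (ht : 0 < t) (n : ℤ) :
    mlLine α t n + mlLine α t (n + 1) = 2 * mlKernel α t n := by
  obtain ⟨κ, hκ, hκ'⟩ : ∃ κ, π / 2 < κ ∧ κ < π / α :=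
    exists_between (div_lt_div_of_pos_left Real.pi_pos hα hα2)
  obtain ⟨C, hC⟩ := Complex.exists_norm_inv_Gamma_le hκ (α * (n + 1 / 2)) (α * (n + 3 / 2))
  have hcont : ContinuousOn (fun x : ℝ => t ^ x) (Icc (n - 1 / 2 : ℝ) (n + 1 / 2)) :=
    (Real.continuous_const_rpow ht.ne').continuousOn
  obtain ⟨B, hB⟩ := isCompact_Icc.exists_bound_of_continuousOn hcont
  have h := integral_add_integral_eq_two_mul (g := fun z => mlKernel α t (n + z))
    (C := B * C) (κ := κ * α) ((differentiable_mlKernel ht).comp (by fun_prop))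
    ((lt_div_iff₀ hα).1 hκ') fun z hz => by
      rw [abs_le] at hz
      have h1 := hC (α * (n + z) + α) (by
        simp only [Complex.add_re, Complex.re_ofReal_mul, Complex.intCast_re, Complex.ofReal_re]
        constructor <;> nlinarith [hz.1, hz.2])
      have h2 := hB (n + z.re) ⟨by linarith [hz.1], by linarith [hz.2]⟩
      rw [norm_mlKernel ht, Complex.add_re, Complex.intCast_re]
      refine (mul_le_mul ((le_abs_self _).trans h2) h1 (norm_nonneg _)
        ((norm_nonneg _).trans h2)).trans_eq ?_
      simp [abs_mul, abs_of_pos hα, mul_assoc]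
  simp only [add_zero] at h
  rw [← h, mlLine, mlLine]
  congr 2 <;> ext y <;> congr 2 <;> push_cast <;> ring

theorem mlKernel_natCast (k : ℕ) :
    (-1) ^ k * mlKernel α t k = (((-t) ^ k / Real.Gamma (k * α + α) : ℝ) : ℂ) := by
  rw [mlKernel, Complex.cpow_natCast, neg_pow t]
  push_cast
  rw [← Complex.Gamma_ofReal]
  push_cast
  ring_nf

theorem sum_range_mlKernel (hα : 0 < α) (hα2 : α < 2) (ht : 0 < t) (N : ℕ) :
    ∑ k ∈ Finset.range N, (-1) ^ k * mlKernel α t k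
      = (mlLine α t 0 - (-1) ^ N * mlLine α t N) / 2 := by
  induction N with
  | zero => simp
  | succ N ih =>
    rw [Finset.sum_range_succ, ih]
    have h := mlLine_add_mlLine_add_one hα hα2 ht N
    push_cast at h ⊢
    rw [pow_succ]
    linear_combination (-(-1) ^ N / 2) * h

theorem norm_mlLine_le (hα : 0 < α) (ht : 0 < t) {n : ℕ} (hn : 1 / 2 ≤ n * α + α / 2)
    (hα2 : α < 2) :
    ‖mlLine α t n‖ ≤ t ^ (-1 / 2 : ℝ) * (t ^ n / Real.Gamma (n * α + α / 2)) *
      ∫ y : ℝ, 2 * Real.exp (-((π - π / 2 * α) * |y|)) := by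
  have hpos : 0 < π - π / 2 * α := by nlinarith [Real.pi_pos]
  rw [← integral_const_mul]
  refine norm_integral_le_of_norm_le
    (((integrable_exp_neg_mul_abs hpos).const_mul 2).const_mul _) (ae_of_all _ fun y => ?_)
  have hre : ((α : ℂ) * ((n : ℤ) - 1 / 2 + y * Complex.I) + α).re = n * α + α / 2 := by
    simp; ring
  have him : ((α : ℂ) * ((n : ℤ) - 1 / 2 + y * Complex.I) + α).im = α * y := by
    simp
  have hG := Complex.norm_inv_Gamma_le (z := α * ((n : ℤ) - 1 / 2 + y * Complex.I) + α)
    (by rwa [hre])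
  rw [hre, him, abs_mul, abs_of_pos hα] at hG
  have hGpos : 0 < Real.Gamma (n * α + α / 2) := Real.Gamma_pos_of_pos (by linarith)
  have hexp : (((n : ℤ) : ℂ) - 1 / 2 + y * Complex.I).re = -1 / 2 + n := by
    simp; ring
  rw [norm_mul, norm_mlKernel ht, hexp, Real.rpow_add ht, Real.rpow_natCast, Complex.norm_real,
    Real.norm_of_nonneg (inv_nonneg.2 (Real.cosh_pos _).le)]
  have hcosh := Real.inv_cosh_le (π * y)
  rw [abs_mul, abs_of_pos Real.pi_pos] at hcosh
  calc _ ≤ t ^ (-1 / 2 : ℝ) * t ^ n *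
        ((Real.Gamma (n * α + α / 2))⁻¹ * Real.exp (π / 2 * (α * |y|))) *
        (2 * Real.exp (-(π * |y|))) := by gcongr
    _ = _ := by
      rw [show -((π - π / 2 * α) * |y|) = π / 2 * (α * |y|) + -(π * |y|) by ring, Real.exp_add]
      ring

theorem tendsto_mlLine_atTop (hα : 0 < α) (hα2 : α < 2) (ht : 0 < t) :
    Tendsto (fun n : ℕ => mlLine α t n) atTop (𝓝 0) := by
  have hs := (((summable_pow_div_Gamma hα (α / 2) t).tendsto_atTop_zero.const_mul
    (t ^ (-1 / 2 : ℝ))).mul_const (∫ y : ℝ, 2 * Real.exp (-((π - π / 2 * α) * |y|))))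
  rw [mul_zero, zero_mul] at hs
  refine squeeze_zero_norm' ?_ hs
  obtain ⟨N, hN⟩ := exists_nat_ge (1 / 2 / α)
  filter_upwards [eventually_ge_atTop N] with n hn
  refine norm_mlLine_le hα ht ?_ hα2
  have : 1 / 2 / α ≤ n := hN.trans (by exact_mod_cast hn)
  rw [div_le_iff₀ hα] at this
  linarith

theorem mlR_neg_eq_mlLine (hα : 0 < α) (hα2 : α < 2) (ht : 0 < t) :
    (mlR α α (-t) : ℂ) = mlLine α t 0 / 2 := by
  have hsum := (summable_pow_div_Gamma hα α (-t)).hasSum.tendsto_sum_nat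
  have h1 : Tendsto (fun N : ℕ => ∑ k ∈ Finset.range N, (-1) ^ k * mlKernel α t k) atTop
      (𝓝 (mlR α α (-t) : ℂ)) := by
    simp only [mlKernel_natCast, ← Complex.ofReal_sum]
    exact (Complex.continuous_ofReal.tendsto _).comp hsum
  refine tendsto_nhds_unique h1 ?_
  simp only [sum_range_mlKernel hα hα2 ht]
  have h2 : Tendsto (fun N : ℕ => (-1 : ℂ) ^ N * mlLine α t N) atTop (𝓝 0) := by
    rw [tendsto_zero_iff_norm_tendsto_zero]
    simpa using (tendsto_mlLine_atTop hα hα2 ht).norm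
  simpa using (h2.const_sub (mlLine α t 0)).div_const 2

theorem sq_mul_mlR_neg (hα : 0 < α) (hα2 : α < 2) (ht : 0 < t) :
    ((t ^ 2 * mlR α α (-t) : ℝ) : ℂ)
      = ((-1 / Real.Gamma (-α) : ℝ) : ℂ) + (t : ℂ) ^ 2 * mlLine α t (-2) / 2 := by
  have h1 := mlLine_add_mlLine_add_one hα hα2 ht (-1)
  have h2 := mlLine_add_mlLine_add_one hα hα2 ht (-2)
  have k1 : mlKernel α t ((-1 : ℤ) : ℂ) = 0 := by simp [mlKernel, Complex.Gamma_zero]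
  have k2 : (t : ℂ) ^ 2 * mlKernel α t ((-2 : ℤ) : ℂ) = (Complex.Gamma (-α))⁻¹ := by
    have ht' : (t : ℂ) ≠ 0 := by exact_mod_cast ht.ne'
    rw [mlKernel, Complex.cpow_intCast, ← mul_assoc, ← zpow_natCast, ← zpow_add₀ ht']
    push_cast
    simp only [zpow_zero, one_mul]
    ring_nf
  rw [k1] at h1
  norm_num at h1 h2 k2
  push_cast
  rw [mlR_neg_eq_mlLine hα hα2 ht, ← Complex.Gamma_ofReal, neg_div, one_div]
  push_cast
  linear_combination (t : ℂ) ^ 2 / 2 * h1 - (t : ℂ) ^ 2 / 2 * h2 - k2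

theorem norm_mlLine_neg_two_le (ht : 0 < t) :
    ‖mlLine α t (-2)‖ ≤ t ^ (-5 / 2 : ℝ) * ∫ y : ℝ,
      ‖(Complex.Gamma (α * ((-2 : ℤ) - 1 / 2 + y * Complex.I) + α))⁻¹‖ *
        (Real.cosh (π * y))⁻¹ := by
  rw [← integral_const_mul]
  refine (norm_integral_le_integral_norm _).trans_eq (integral_congr_ae (ae_of_all _ fun y => ?_))
  have hre : (((-2 : ℤ) : ℂ) - 1 / 2 + y * Complex.I).re = -5 / 2 := by
    simp; norm_num
  simp only [norm_mul, norm_mlKernel ht, hre, Complex.norm_real,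
    Real.norm_of_nonneg (inv_nonneg.2 (Real.cosh_pos _).le), mul_assoc]

theorem tendsto_sq_mul_mlR_neg (hα : 0 < α) (hα2 : α < 2) :
    Tendsto (fun t : ℝ => t ^ 2 * mlR α α (-t)) atTop (𝓝 (-1 / Real.Gamma (-α))) := by
  set K : ℝ := ∫ y : ℝ, ‖(Complex.Gamma (α * ((-2 : ℤ) - 1 / 2 + y * Complex.I) + α))⁻¹‖ *
    (Real.cosh (π * y))⁻¹
  have hlim : Tendsto (fun t : ℝ => t ^ (-(1 / 2) : ℝ) * (K / 2)) atTop (𝓝 0) := by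
    simpa using (tendsto_rpow_neg_atTop (by norm_num : (0 : ℝ) < 1 / 2)).mul_const (K / 2)
  rw [tendsto_iff_norm_sub_tendsto_zero]
  refine squeeze_zero' (Eventually.of_forall fun _ => norm_nonneg _) ?_ hlim
  filter_upwards [eventually_gt_atTop 0] with t ht
  rw [← Complex.norm_real, Complex.ofReal_sub, sq_mul_mlR_neg hα hα2 ht, add_sub_cancel_left,
    norm_div, norm_mul, norm_pow, Complex.norm_real, Real.norm_of_nonneg ht.le]
  have h := norm_mlLine_neg_two_le (α := α) ht
  have hpow : t ^ (-(1 / 2) : ℝ) = t ^ 2 * t ^ (-5 / 2 : ℝ) := by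
    rw [← Real.rpow_natCast, ← Real.rpow_add ht]
    norm_num
  rw [hpow, RCLike.norm_ofNat]
  calc t ^ 2 * ‖mlLine α t (-2)‖ / 2 ≤ t ^ 2 * (t ^ (-5 / 2 : ℝ) * K) / 2 := by gcongr
    _ = _ := by ring

end MittagLeffler

/-- Quadratic decay of `E_{α,α}` on the negative real axis. -/
theorem stmt_4 (α : ℝ) (hα : α ∈ Set.Ioo (0:ℝ) 1 ∨ α ∈ Set.Ioo (1:ℝ) 2) :
    Filter.Tendsto (fun t : ℝ => t ^ 2 * mlR α α (-t)) Filter.atTop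
      (nhds (-1 / Real.Gamma (-α))) := by
  rcases hα with h | h
  · exact tendsto_sq_mul_mlR_neg h.1 (by linarith [h.2])
  · exact tendsto_sq_mul_mlR_neg (by linarith [h.1]) h.2
end

section
/- Let α ∈ (0,1]. Then the function φ(t) = E_{α,1}(−t) is completely monotone on [0,∞), i.e. φ is infinitely differentiable on (0,∞) and (−1)^n φ^{(n)}(t) ≥ 0 for all t > 0 and all n ∈ ℕ. In particular, for every t > 0 one has 0 < E_{α,1}(−t) < 1 = E_{α,1}(0), and t ↦ E_{α,1}(−t) is strictly decreasing on [0,∞), so that for 0 < λ₁ < λ₂ and T > 0 one has 1 > E_{α,1}(−λ₁T^α) > E_{α,1}(−λ₂T^α) > 0. -/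
open scoped Real

/-- A real sequence is Stieltjes positive if the linear functional `x ^ k ↦ m k` is nonnegative on
polynomials that are nonnegative on `[0, ∞)`. -/
def StieltjesPositive (m : ℕ → ℝ) : Prop :=
  ∀ (N : ℕ) (a : ℕ → ℝ), (∀ x : ℝ, 0 ≤ x → 0 ≤ ∑ k ∈ Finset.range N, a k * x ^ k) →
    0 ≤ ∑ k ∈ Finset.range N, a k * m k

namespace StieltjesPositive

theorem geometric {c : ℝ} (hc : 0 ≤ c) : StieltjesPositive (fun k => c ^ k) :=
  fun _ _ ha => ha c hc

theorem of_tendsto {m : ℕ → ℝ} {u : ℕ → ℕ → ℝ}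
    (hu : ∀ᶠ n in Filter.atTop, StieltjesPositive (u n))
    (h : ∀ k, Filter.Tendsto (fun n => u n k) Filter.atTop (nhds (m k))) :
    StieltjesPositive m := by
  intro N a ha
  refine ge_of_tendsto (tendsto_finsetSum (Finset.range N) fun k _ => (h k).const_mul (a k)) ?_
  filter_upwards [hu] with n hn using hn N a ha

theorem shift {m : ℕ → ℝ} (hm : StieltjesPositive m) (i : ℕ) :
    StieltjesPositive (fun k => m (k + i)) := by
  intro N a ha
  have key : ∀ f : ℕ → ℝ, ∑ k ∈ Finset.range (i + N), (if i ≤ k then a (k - i) else 0) * f k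
      = ∑ k ∈ Finset.range N, a k * f (k + i) := by
    intro f
    rw [Finset.sum_range_add, Finset.sum_eq_zero, zero_add]
    · exact Finset.sum_congr rfl fun k _ => by simp [add_comm]
    · intro k hk
      simp [Finset.mem_range.1 hk]
  have := hm (i + N) (fun k => if i ≤ k then a (k - i) else 0) fun x hx => by
    rw [key]
    have h := mul_nonneg (ha x hx) (pow_nonneg hx i)
    rw [Finset.sum_mul] at h
    exact h.trans_eq (Finset.sum_congr rfl fun k _ => by ring)
  rwa [key] at this

theorem mul_ratio {m : ℕ → ℝ} (hm : StieltjesPositive m) {α : ℝ} (h0 : 0 ≤ α) (h1 : α ≤ 1)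
    (j : ℕ) : StieltjesPositive (fun k => m k * ((α * k + 1 + j) / (k + 1 + j))) := by
  intro N a ha
  have := hm N (fun k => a k * ((α * k + 1 + j) / (k + 1 + j))) fun x hx => by
    have hint : 0 ≤ ∫ v in (0:ℝ)..1,
        ∑ k ∈ Finset.range N, a k * x ^ k * ((j + 1) * v ^ (k + j)) := by
      refine intervalIntegral.integral_nonneg zero_le_one fun v hv => ?_
      have h := mul_nonneg (ha (x * v) (mul_nonneg hx hv.1))
        (by have := hv.1; positivity : 0 ≤ ((j : ℝ) + 1) * v ^ j)
      rw [Finset.sum_mul] at h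
      exact h.trans_eq (Finset.sum_congr rfl fun k _ => by ring)
    rw [intervalIntegral.integral_finsetSum
      (fun k _ => Continuous.intervalIntegrable (by fun_prop) _ _)] at hint
    have h := add_nonneg (mul_nonneg h0 (ha x hx)) (mul_nonneg (sub_nonneg.2 h1) hint)
    rw [Finset.mul_sum, Finset.mul_sum, ← Finset.sum_add_distrib] at h
    refine h.trans_eq (Finset.sum_congr rfl fun k _ => ?_)
    rw [intervalIntegral.integral_const_mul, intervalIntegral.integral_const_mul, integral_pow]
    have : (k : ℝ) + 1 + j ≠ 0 := by positivity
    have : (k : ℝ) + j + 1 ≠ 0 := by positivity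
    push_cast
    simp only [one_pow, zero_pow (Nat.succ_ne_zero _), sub_zero]
    field_simp
    ring
  exact this.trans_eq (Finset.sum_congr rfl fun k _ => by ring)

theorem mul_prod_ratio {m : ℕ → ℝ} (hm : StieltjesPositive m) {α : ℝ} (h0 : 0 ≤ α) (h1 : α ≤ 1)
    (n : ℕ) : StieltjesPositive
      (fun k => m k * ∏ j ∈ Finset.range n, ((α * k + 1 + j) / (k + 1 + j))) := by
  induction n with
  | zero => simpa using hm
  | succ n ih =>
    simp only [Finset.prod_range_succ, ← mul_assoc]
    exact ih.mul_ratio h0 h1 n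

end StieltjesPositive

/-- The moments `k! / Γ(α k + 1)` of the Mittag-Leffler distribution. -/
noncomputable def mittagLefflerMoment (α : ℝ) (k : ℕ) : ℝ :=
  k.factorial / Real.Gamma (k * α + 1)

theorem mittagLefflerMoment_pos {α : ℝ} (h0 : 0 ≤ α) (k : ℕ) : 0 < mittagLefflerMoment α k :=
  div_pos (by positivity) (Real.Gamma_pos_of_pos (by positivity))

theorem stieltjesPositive_mittagLefflerMoment {α : ℝ} (h0 : 0 ≤ α) (h1 : α ≤ 1) :
    StieltjesPositive (mittagLefflerMoment α) := by
  refine StieltjesPositive.of_tendsto (u := fun n k => ((n : ℝ) ^ (1 - α)) ^ k *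
    ∏ j ∈ Finset.range (n + 1), ((α * k + 1 + j) / (k + 1 + j)))
    (Filter.Eventually.of_forall fun n =>
      (StieltjesPositive.geometric (by positivity)).mul_prod_ratio h0 h1 (n + 1)) fun k => ?_
  have hG : Real.Gamma (α * k + 1) ≠ 0 := (Real.Gamma_pos_of_pos (by positivity)).ne'
  have h := (Real.GammaSeq_tendsto_Gamma ((k : ℝ) + 1)).div
    (Real.GammaSeq_tendsto_Gamma (α * k + 1)) hG
  rw [Real.Gamma_nat_eq_factorial, mul_comm α] at h
  refine h.congr' ?_
  filter_upwards [Filter.eventually_gt_atTop 0] with n hn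
  have hn' : (0 : ℝ) < n := by exact_mod_cast hn
  have e1 : ((n : ℝ) ^ (1 - α)) ^ k * (n : ℝ) ^ (k * α + 1) = (n : ℝ) ^ ((k : ℝ) + 1) := by
    rw [← Real.rpow_natCast, ← Real.rpow_mul hn'.le, ← Real.rpow_add hn']
    ring_nf
  simp only [Pi.div_apply, Real.GammaSeq]
  rw [Finset.prod_div_distrib, ← e1, mul_comm α]
  have p1 : ∏ j ∈ Finset.range (n + 1), ((k : ℝ) + 1 + j) ≠ 0 :=
    Finset.prod_ne_zero_iff.2 fun j _ => by positivity
  have p2 : ∏ j ∈ Finset.range (n + 1), ((k : ℝ) * α + 1 + j) ≠ 0 :=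
    Finset.prod_ne_zero_iff.2 fun j _ => by positivity
  have p3 : (n : ℝ) ^ ((k : ℝ) * α + 1) ≠ 0 := by positivity
  have p4 : (n.factorial : ℝ) ≠ 0 := by positivity
  field_simp

/-- The Taylor polynomials of `exp (-x)` alternately bound it from above and below. -/
theorem exp_neg_taylor_alternating (n : ℕ) : ∀ x : ℝ, 0 ≤ x →
    0 ≤ (-1 : ℝ) ^ n * (Real.exp (-x) - ∑ k ∈ Finset.range n, (-x) ^ k / k.factorial) := by
  induction n with
  | zero => intro x _; simpa using (Real.exp_pos _).le
  | succ n ih =>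
    have hd : ∀ x : ℝ, HasDerivAt (fun x : ℝ => (-1 : ℝ) ^ (n + 1) *
        (Real.exp (-x) - ∑ k ∈ Finset.range (n + 1), (-x) ^ k / k.factorial))
        ((-1 : ℝ) ^ n * (Real.exp (-x) - ∑ k ∈ Finset.range n, (-x) ^ k / k.factorial)) x := by
      intro x
      have hs : HasDerivAt (fun x : ℝ => ∑ k ∈ Finset.range n,
          (-x) ^ (k + 1) / ((k + 1).factorial : ℝ))
          (∑ k ∈ Finset.range n, -((-x) ^ k / (k.factorial : ℝ))) x := by
        refine HasDerivAt.fun_sum fun k _ => ?_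
        refine (((hasDerivAt_neg x).pow (k + 1)).div_const _).congr_deriv ?_
        rw [Nat.factorial_succ]
        push_cast
        field_simp
      simp only [Finset.sum_range_succ', pow_zero]
      refine ((((hasDerivAt_neg x).exp).fun_sub (hs.add_const _)).const_mul _).congr_deriv ?_
      rw [Finset.sum_neg_distrib]
      ring
    have hmono : MonotoneOn (fun x : ℝ => (-1 : ℝ) ^ (n + 1) *
        (Real.exp (-x) - ∑ k ∈ Finset.range (n + 1), (-x) ^ k / k.factorial)) (Set.Ici 0) := by
      refine monotoneOn_of_deriv_nonneg (convex_Ici 0)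
        (fun x _ => (hd x).continuousAt.continuousWithinAt)
        (fun x _ => (hd x).differentiableAt.differentiableWithinAt) fun x hx => ?_
      rw [interior_Ici] at hx
      rw [(hd x).deriv]
      exact ih x (le_of_lt hx)
    intro x hx
    refine le_trans (le_of_eq ?_) (hmono (Set.mem_Ici.2 le_rfl) hx hx)
    simp [Finset.sum_range_succ']

/-- If `x ↦ b₀ + b₁ x` minorizes `exp (-t x)` on `[0, ∞)`, the same holds after applying the moment
functional. -/
theorem StieltjesPositive.le_tsum_of_affine_le_exp {m : ℕ → ℝ} (hm : StieltjesPositive m)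
    {t b₀ b₁ : ℝ} (ht : 0 ≤ t) (hs : Summable fun k : ℕ => (-t) ^ k / k.factorial * m k)
    (hb : ∀ x : ℝ, 0 ≤ x → b₀ + b₁ * x ≤ Real.exp (-(t * x))) :
    b₀ * m 0 + b₁ * m 1 ≤ ∑' k : ℕ, (-t) ^ k / k.factorial * m k := by
  have hlim := hs.hasSum.tendsto_sum_nat.comp
    (Filter.tendsto_atTop_mono (fun N : ℕ => by omega : ∀ N : ℕ, N ≤ 2 * N + 1 + 2)
      Filter.tendsto_id)
  refine ge_of_tendsto' hlim fun N => ?_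
  have key : ∀ f : ℕ → ℝ, ∑ k ∈ Finset.range (2 * N + 1 + 2),
      ((-t) ^ k / k.factorial - (if k = 0 then b₀ else 0) - (if k = 1 then b₁ else 0)) * f k
      = ∑ k ∈ Finset.range (2 * N + 1 + 2), (-t) ^ k / k.factorial * f k
        - (b₀ * f 0 + b₁ * f 1) := by
    intro f
    simp only [sub_mul, Finset.sum_sub_distrib, ite_mul, zero_mul, Finset.sum_ite_eq',
      Finset.mem_range]
    rw [if_pos (by omega), if_pos (by omega)]
    ring
  have h := hm (2 * N + 1 + 2) (fun k => (-t) ^ k / k.factorial - (if k = 0 then b₀ else 0)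
    - (if k = 1 then b₁ else 0)) fun x hx => by
      rw [key]
      have h1 := exp_neg_taylor_alternating (2 * N + 1 + 2) (t * x) (mul_nonneg ht hx)
      rw [Odd.neg_one_pow ⟨N + 1, by ring⟩] at h1
      have h2 := hb x hx
      have h3 : ∑ k ∈ Finset.range (2 * N + 1 + 2), (-(t * x)) ^ k / (k.factorial : ℝ)
          = ∑ k ∈ Finset.range (2 * N + 1 + 2), (-t) ^ k / k.factorial * x ^ k :=
        Finset.sum_congr rfl fun k _ => by rw [neg_mul_eq_neg_mul, mul_pow]; ring
      rw [← h3]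
      simp only [pow_zero, pow_one, mul_one]
      linarith
  rw [key] at h
  simpa using h

theorem Real.rpow_mul_exp_neg_le_Gamma {x R : ℝ} (hx : 0 ≤ x) (hR : 0 < R) :
    R ^ x * Real.exp (-R) ≤ Real.Gamma (x + 1) := by
  rw [Real.Gamma_eq_integral (by linarith), ← integral_exp_neg_Ioi,
    ← MeasureTheory.integral_const_mul]
  have hint := Real.GammaIntegral_convergent (show 0 < x + 1 by linarith)
  have hsub : Set.Ioi R ⊆ Set.Ioi 0 := Set.Ioi_subset_Ioi hR.le
  refine le_trans (MeasureTheory.setIntegral_mono_on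
      ((integrableOn_exp_neg_Ioi R).const_mul _) (hint.mono_set hsub) measurableSet_Ioi ?_)
    (MeasureTheory.setIntegral_mono_set hint ?_ hsub.eventuallyLE)
  · intro y hy
    rw [mul_comm, add_sub_cancel_right]
    gcongr
    exact le_of_lt hy
  · filter_upwards [MeasureTheory.ae_restrict_mem measurableSet_Ioi] with y hy
    have : 0 < y := hy
    simp only [Pi.zero_apply]
    positivity

theorem mittagLefflerMoment_le {α : ℝ} (h0 : 0 < α) {R : ℝ} (hR : 0 < R) :
    ∃ C : ℝ, 0 ≤ C ∧ ∀ k : ℕ, mittagLefflerMoment α k ≤ C * (k.factorial / R ^ k) := by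
  refine ⟨Real.exp (R ^ (1 / α)), by positivity, fun k => ?_⟩
  have h := Real.rpow_mul_exp_neg_le_Gamma (x := k * α) (by positivity)
    (Real.rpow_pos_of_pos hR (1 / α))
  rw [← Real.rpow_mul hR.le, show 1 / α * (k * α) = k by field_simp, Real.rpow_natCast,
    Real.exp_neg] at h
  unfold mittagLefflerMoment
  calc (k.factorial : ℝ) / Real.Gamma (k * α + 1)
      ≤ k.factorial / (R ^ k * (Real.exp (R ^ (1 / α)))⁻¹) := by gcongr
    _ = _ := by field_simp

theorem summable_mittagLefflerMoment {α : ℝ} (h0 : 0 < α) (i : ℕ) {r : ℝ} (hr : 0 ≤ r) :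
    Summable fun k : ℕ => r ^ k / k.factorial * mittagLefflerMoment α (k + i) := by
  have hR : 0 < 4 * r + 1 := by positivity
  obtain ⟨C, hC, h⟩ := mittagLefflerMoment_le h0 hR
  have hq : 2 * r / (4 * r + 1) < 1 := by rw [div_lt_one hR]; linarith
  refine Summable.of_nonneg_of_le (fun k => ?_) (fun k => ?_)
    ((summable_geometric_of_lt_one (by positivity) hq).mul_left
      (C * i.factorial * (2 / (4 * r + 1)) ^ i))
  · have := (mittagLefflerMoment_pos h0.le (k + i)).le
    positivity
  · have hf : ((k + i).factorial : ℝ) ≤ 2 ^ (k + i) * k.factorial * i.factorial := by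
      rw [← Nat.add_choose_mul_factorial_mul_factorial k i]
      push_cast
      gcongr
      exact_mod_cast Nat.choose_le_two_pow _ _
    calc r ^ k / k.factorial * mittagLefflerMoment α (k + i)
        ≤ r ^ k / k.factorial * (C * ((2 ^ (k + i) * k.factorial * i.factorial)
          / (4 * r + 1) ^ (k + i))) := by
          have := h (k + i)
          gcongr
          exact this.trans (by gcongr)
      _ = _ := by
          rw [div_pow, div_pow, mul_pow, pow_add, pow_add]
          field_simp

/-- The `i`-th derivative of `s ↦ E_{α,1}(-s)`, up to the sign `(-1) ^ i`. -/
noncomputable def mittagLefflerDeriv (α : ℝ) (i : ℕ) (t : ℝ) : ℝ :=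
  ∑' k : ℕ, (-t) ^ k / k.factorial * mittagLefflerMoment α (k + i)

theorem summable_mittagLefflerDeriv {α : ℝ} (h0 : 0 < α) (i : ℕ) (t : ℝ) :
    Summable fun k : ℕ => (-t) ^ k / k.factorial * mittagLefflerMoment α (k + i) := by
  refine Summable.of_norm ((summable_mittagLefflerMoment h0 i (abs_nonneg t)).congr fun k => ?_)
  simp [abs_of_pos (mittagLefflerMoment_pos h0.le (k + i))]

theorem hasDerivAt_mittagLefflerDeriv {α : ℝ} (h0 : 0 < α) (i : ℕ) (t : ℝ) :
    HasDerivAt (mittagLefflerDeriv α i) (-mittagLefflerDeriv α (i + 1) t) t := by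
  have hr : (0 : ℝ) ≤ |t| + 1 := by positivity
  have hbase := summable_mittagLefflerDeriv h0 i t
  have hterm : ∀ (k : ℕ) (s : ℝ), HasDerivAt
      (fun s : ℝ => (-s) ^ (k + 1) / (k + 1).factorial * mittagLefflerMoment α (k + 1 + i))
      (-((-s) ^ k / k.factorial * mittagLefflerMoment α (k + (i + 1)))) s := by
    intro k s
    refine ((((hasDerivAt_neg s).pow (k + 1)).div_const _).mul_const _).congr_deriv ?_
    rw [Nat.factorial_succ, show k + 1 + i = k + (i + 1) by ring]
    push_cast
    field_simp
  have h := hasDerivAt_tsum_of_isPreconnected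
    (summable_mittagLefflerMoment h0 (i + 1) hr) (t := Metric.ball 0 (|t| + 1))
    Metric.isOpen_ball (convex_ball _ _).isPreconnected (fun k s _ => hterm k s)
    (fun k s hs => by
      have hs' : |s| ≤ |t| + 1 := by simpa using (mem_ball_zero_iff.1 hs).le
      have := (mittagLefflerMoment_pos h0.le (k + (i + 1))).le
      rw [norm_neg, norm_mul, norm_div, norm_pow, norm_neg, Real.norm_eq_abs, Real.norm_natCast,
        Real.norm_of_nonneg this]
      gcongr)
    (y₀ := t) (y := t) (by simp) ((summable_nat_add_iff 1).2 hbase) (by simp)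
  rw [tsum_neg] at h
  refine (h.add_const (mittagLefflerMoment α (0 + i))).congr_of_eventuallyEq
    (Filter.Eventually.of_forall fun s => ?_)
  simp only [mittagLefflerDeriv]
  rw [(summable_mittagLefflerDeriv h0 i s).tsum_eq_zero_add]
  simp [add_comm]

theorem iteratedDeriv_mittagLefflerDeriv {α : ℝ} (h0 : 0 < α) (n : ℕ) :
    iteratedDeriv n (mittagLefflerDeriv α 0) = fun t => (-1) ^ n * mittagLefflerDeriv α n t := by
  induction n with
  | zero => simp
  | succ n ih =>
    rw [iteratedDeriv_succ, ih]
    funext t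
    rw [((hasDerivAt_mittagLefflerDeriv h0 n t).const_mul _).deriv]
    ring

theorem mlR_neg_eq_mittagLefflerDeriv (α s : ℝ) : mlR α 1 (-s) = mittagLefflerDeriv α 0 s := by
  refine tsum_congr fun k => ?_
  have : (k.factorial : ℝ) ≠ 0 := by positivity
  simp only [mittagLefflerMoment, add_zero]
  field_simp

theorem mittagLefflerDeriv_zero (α : ℝ) (i : ℕ) :
    mittagLefflerDeriv α i 0 = mittagLefflerMoment α i := by
  rw [mittagLefflerDeriv, tsum_eq_single 0 fun k hk => by simp [hk]]
  simp

/-- Jensen's inequality against the tangent of `x ↦ exp (-t x)` at the mean makes the derivative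
strictly positive. -/
theorem mittagLefflerDeriv_pos {α : ℝ} (h0 : 0 < α) (h1 : α ≤ 1) (i : ℕ) {t : ℝ}
    (ht : 0 ≤ t) : 0 < mittagLefflerDeriv α i t := by
  have p0 := mittagLefflerMoment_pos h0.le i
  set A := mittagLefflerMoment α (1 + i) / mittagLefflerMoment α i with hA
  have h := ((stieltjesPositive_mittagLefflerMoment h0.le h1).shift i).le_tsum_of_affine_le_exp
    (b₀ := Real.exp (-(t * A)) * (1 + t * A)) (b₁ := -(Real.exp (-(t * A)) * t)) ht
    (summable_mittagLefflerDeriv h0 i t) fun x _ => by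
      have := Real.add_one_le_exp (-(t * x) + t * A)
      calc _ = Real.exp (-(t * A)) * (-(t * x) + t * A + 1) := by ring
        _ ≤ Real.exp (-(t * A)) * Real.exp (-(t * x) + t * A) := by gcongr
        _ = _ := by rw [← Real.exp_add]; ring_nf
  refine lt_of_lt_of_le (mul_pos (Real.exp_pos (-(t * A))) p0) (le_trans (le_of_eq ?_) h)
  have : mittagLefflerMoment α (1 + i) = A * mittagLefflerMoment α i := by
    rw [hA]; field_simp
  simp only [this, zero_add]
  ring

theorem strictAntiOn_mittagLefflerDeriv {α : ℝ} (h0 : 0 < α) (h1 : α ≤ 1) (i : ℕ) :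
    StrictAntiOn (mittagLefflerDeriv α i) (Set.Ici 0) := by
  refine strictAntiOn_of_deriv_neg (convex_Ici 0)
    (fun x _ => (hasDerivAt_mittagLefflerDeriv h0 i x).continuousAt.continuousWithinAt)
    fun x hx => ?_
  rw [interior_Ici] at hx
  rw [(hasDerivAt_mittagLefflerDeriv h0 i x).deriv]
  exact neg_neg_of_pos (mittagLefflerDeriv_pos h0 h1 (i + 1) (le_of_lt hx))

/-- Complete monotonicity of `E_{α,1}(−t)` for `0 < α ≤ 1`, and its consequences. -/
theorem stmt_5 (α : ℝ) (hα : α ∈ Set.Ioc (0:ℝ) 1) :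
    (∀ t ∈ Set.Ioi (0:ℝ), ContDiffAt ℝ (⊤ : ℕ∞) (fun s : ℝ => mlR α 1 (-s)) t) ∧
    (∀ n : ℕ, ∀ t ∈ Set.Ioi (0:ℝ),
      0 ≤ (-1 : ℝ) ^ n * iteratedDeriv n (fun s : ℝ => mlR α 1 (-s)) t) ∧
    (∀ t ∈ Set.Ioi (0:ℝ), 0 < mlR α 1 (-t) ∧ mlR α 1 (-t) < 1) ∧
    mlR α 1 (-(0:ℝ)) = 1 ∧
    StrictAntiOn (fun s : ℝ => mlR α 1 (-s)) (Set.Ici 0) ∧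
    (∀ lam₁ lam₂ T : ℝ, 0 < lam₁ → lam₁ < lam₂ → 0 < T →
      1 > mlR α 1 (-(lam₁ * T ^ α)) ∧
      mlR α 1 (-(lam₁ * T ^ α)) > mlR α 1 (-(lam₂ * T ^ α)) ∧
      mlR α 1 (-(lam₂ * T ^ α)) > 0) := by
  obtain ⟨h0, h1⟩ := hα
  have hzero : mittagLefflerDeriv α 0 0 = 1 := by
    simp [mittagLefflerDeriv_zero, mittagLefflerMoment]
  have hanti := strictAntiOn_mittagLefflerDeriv h0 h1 0
  have hpos : ∀ t : ℝ, 0 < t → 0 < mittagLefflerDeriv α 0 t :=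
    fun t ht => mittagLefflerDeriv_pos h0 h1 0 ht.le
  have hlt : ∀ t : ℝ, 0 < t → mittagLefflerDeriv α 0 t < 1 :=
    fun t ht => hzero ▸ hanti (Set.mem_Ici.2 le_rfl) ht.le ht
  simp only [mlR_neg_eq_mittagLefflerDeriv]
  refine ⟨fun t _ => ContDiff.contDiffAt ?_, fun n t ht => ?_, fun t ht => ⟨hpos t ht, hlt t ht⟩,
    hzero, hanti, fun lam₁ lam₂ T hl hl' hT => ?_⟩
  · refine contDiff_of_differentiable_iteratedDeriv fun n _ => ?_
    rw [iteratedDeriv_mittagLefflerDeriv h0]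
    exact fun t => ((hasDerivAt_mittagLefflerDeriv h0 n t).const_mul _).differentiableAt
  · rw [iteratedDeriv_mittagLefflerDeriv h0, ← mul_assoc, ← mul_pow, neg_one_mul, neg_neg, one_pow,
      one_mul]
    exact (mittagLefflerDeriv_pos h0 h1 n (le_of_lt ht)).le
  · have hTα : 0 < T ^ α := Real.rpow_pos_of_pos hT α
    have p1 := mul_pos hl hTα
    have p12 := mul_lt_mul_of_pos_right hl' hTα
    exact ⟨hlt _ p1, hanti p1.le (p1.trans p12).le p12, hpos _ (p1.trans p12)⟩
end
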